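/- Let Σ = Λ^ℕ carry the metric d, and for each n ≥ 1 let Σ_n = (Λⁿ)^ℕ be the symbolic Barański carpet over the alphabet Λⁿ ⊆ Λ₁ⁿ × Λ₂ⁿ with weight vectors a_n, b_n, i.e. with metric d[a_n, b_n]. Then dim_H(Σ, d) = lim_{n→∞} dim_H(Σ_n, d[a_n,b_n]) = lim_{n→∞} max_{p ∈ 𝒫(Λⁿ)} g(p, a_n, b_n); in particular both limits exist. -/

import Mathlib

open Set Filter MeasureTheory Metric
open scoped ENNReal NNReal

noncomputable section

/-- Composition of the maps of an IFS along a finite word (in order). -/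
def compWord {Λ : Type*} (f : Λ → ℝ → ℝ) : List Λ → ℝ → ℝ
  | [] => id
  | i :: w => f i ∘ compWord f w

/-- The chain-rule derivative of `compWord f w`, expressed via the derivatives `f'`. -/
def wordDeriv {Λ : Type*} (f f' : Λ → ℝ → ℝ) : List Λ → ℝ → ℝ
  | [] => fun _ => 1
  | i :: w => fun x => f' i (compWord f w x) * wordDeriv f f' w x

/-- `‖f_w'‖`: the sup over `[0,1]` of `|f_w'|`. -/
def wordDerivNorm {Λ : Type*} (f f' : Λ → ℝ → ℝ) (w : List Λ) : ℝ :=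
  sSup ((fun x => |wordDeriv f f' w x|) '' Icc (0:ℝ) 1)

/-- A self-conformal IFS on `[0,1]`: finitely many uniformly contracting differentiable maps
with Hölder continuous non-vanishing derivatives. -/
structure ConformalIFS (Λ : Type*) where
  f : Λ → ℝ → ℝ
  f' : Λ → ℝ → ℝ
  mapsTo : ∀ i, MapsTo (f i) (Icc (0:ℝ) 1) (Icc (0:ℝ) 1)
  hasDeriv : ∀ i, ∀ x ∈ Icc (0:ℝ) 1, HasDerivWithinAt (f i) (f' i x) (Icc (0:ℝ) 1) x
  exponent : ℝ
  exponent_pos : 0 < exponent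
  holder : ∀ i, ∃ C : ℝ, ∀ x ∈ Icc (0:ℝ) 1, ∀ y ∈ Icc (0:ℝ) 1,
    |f' i x - f' i y| ≤ C * |x - y| ^ exponent
  nonvanishing : ∀ i, ∀ x ∈ Icc (0:ℝ) 1, f' i x ≠ 0
  ratio : ℝ
  ratio_pos : 0 < ratio
  ratio_lt_one : ratio < 1
  contracting : ∀ i, ∀ x ∈ Icc (0:ℝ) 1, ∀ y ∈ Icc (0:ℝ) 1, |f i x - f i y| ≤ ratio * |x - y|

/-- The open set condition (with an open subset of `[0,1]`) for a conformal IFS. -/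
def CoordOSC {Λ : Type*} (F : ConformalIFS Λ) : Prop :=
  ∃ U : Set ℝ, U.Nonempty ∧ U ⊆ Icc 0 1 ∧ (∃ O : Set ℝ, IsOpen O ∧ U = O ∩ Icc 0 1) ∧
    (∀ i, F.f i '' U ⊆ U) ∧ Pairwise fun i i' => Disjoint (F.f i '' U) (F.f i' '' U)

end
noncomputable section

/-- `p` is a probability vector indexed by `A` (entries outside `A` vanish). -/
def IsProbVec {Γ₁ Γ₂ : Type*} [Fintype Γ₁] [Fintype Γ₂] (A : Set (Γ₁ × Γ₂))
    (p : Γ₁ × Γ₂ → ℝ) : Prop :=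
  (∀ ij, 0 ≤ p ij) ∧ (∀ ij ∉ A, p ij = 0) ∧ ∑ ij : Γ₁ × Γ₂, p ij = 1

/-- Column sums `q_i(p)`. -/
def colSum {Γ₁ Γ₂ : Type*} [Fintype Γ₂] (p : Γ₁ × Γ₂ → ℝ) (i : Γ₁) : ℝ := ∑ j : Γ₂, p (i, j)

/-- Row sums `r_j(p)`. -/
def rowSum {Γ₁ Γ₂ : Type*} [Fintype Γ₁] (p : Γ₁ × Γ₂ → ℝ) (j : Γ₂) : ℝ := ∑ i : Γ₁, p (i, j)

/-- The first Lyapunov exponent `λ₁(p,a)`. -/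
def lyap1 {Γ₁ Γ₂ : Type*} [Fintype Γ₁] [Fintype Γ₂] (p : Γ₁ × Γ₂ → ℝ) (a : Γ₁ → ℝ) : ℝ :=
  ∑ ij : Γ₁ × Γ₂, p ij * Real.log (a ij.1)

/-- The second Lyapunov exponent `λ₂(p,b)`. -/
def lyap2 {Γ₁ Γ₂ : Type*} [Fintype Γ₁] [Fintype Γ₂] (p : Γ₁ × Γ₂ → ℝ) (b : Γ₂ → ℝ) : ℝ :=
  ∑ ij : Γ₁ × Γ₂, p ij * Real.log (b ij.2)

/-- `g₁(p,a,b)`. -/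
def gOne {Γ₁ Γ₂ : Type*} [Fintype Γ₁] [Fintype Γ₂] (p : Γ₁ × Γ₂ → ℝ) (a : Γ₁ → ℝ)
    (b : Γ₂ → ℝ) : ℝ :=
  (∑ ij : Γ₁ × Γ₂, p ij * Real.log (colSum p ij.1)) / lyap1 p a +
    ((∑ ij : Γ₁ × Γ₂, p ij * Real.log (p ij)) -
      ∑ ij : Γ₁ × Γ₂, p ij * Real.log (colSum p ij.1)) / lyap2 p b

/-- `g₂(p,a,b)`. -/
def gTwo {Γ₁ Γ₂ : Type*} [Fintype Γ₁] [Fintype Γ₂] (p : Γ₁ × Γ₂ → ℝ) (a : Γ₁ → ℝ)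
    (b : Γ₂ → ℝ) : ℝ :=
  (∑ ij : Γ₁ × Γ₂, p ij * Real.log (rowSum p ij.2)) / lyap2 p b +
    ((∑ ij : Γ₁ × Γ₂, p ij * Real.log (p ij)) -
      ∑ ij : Γ₁ × Γ₂, p ij * Real.log (rowSum p ij.2)) / lyap1 p a

/-- `g(p,a,b)`: equal to `g₁` when `λ₁(p,a) ≥ λ₂(p,b)` and to `g₂` otherwise. -/
noncomputable def gFun {Γ₁ Γ₂ : Type*} [Fintype Γ₁] [Fintype Γ₂] (p : Γ₁ × Γ₂ → ℝ)
    (a : Γ₁ → ℝ) (b : Γ₂ → ℝ) : ℝ :=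
  if lyap2 p b ≤ lyap1 p a then gOne p a b else gTwo p a b

/-- The alphabet `Λⁿ`, viewed as a subset of `Λ₁ⁿ × Λ₂ⁿ`. -/
def blockAlphabet {Λ₁ Λ₂ : Type*} (A : Set (Λ₁ × Λ₂)) (n : ℕ) :
    Set ((Fin n → Λ₁) × (Fin n → Λ₂)) :=
  {w | ∀ k, (w.1 k, w.2 k) ∈ A}

/-- Generic "longest common prefix" distance on sequences: `0` for equal sequences, and
otherwise the value `val` of the longest common initial segment. -/
noncomputable def rhoDist {Γ : Type*} (val : List Γ → ℝ) (u v : ℕ → Γ) : ℝ := by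
  classical
  exact if h : u = v then 0
    else val (List.ofFn fun k : Fin (Nat.find (Function.ne_iff.mp h)) => u k.val)

/-- The Barański distance `d[a,b]` on `Γ^ℕ` for `Γ = A ⊆ Γ₁ × Γ₂`:
`d[a,b]((𝚒₁,𝚓₁),(𝚒₂,𝚓₂)) = max {a_{𝚒₁∧𝚒₂}, b_{𝚓₁∧𝚓₂}}`. -/
noncomputable def baranskiDist {Γ₁ Γ₂ : Type*} (A : Set (Γ₁ × Γ₂)) (a : Γ₁ → ℝ) (b : Γ₂ → ℝ)
    (ω₁ ω₂ : ℕ → ↥A) : ℝ :=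
  max
    (rhoDist (fun L => (L.map a).prod)
      (fun k => ((ω₁ k : Γ₁ × Γ₂)).1) (fun k => ((ω₂ k : Γ₁ × Γ₂)).1))
    (rhoDist (fun L => (L.map b).prod)
      (fun k => ((ω₁ k : Γ₁ × Γ₂)).2) (fun k => ((ω₂ k : Γ₁ × Γ₂)).2))

/-- Hausdorff dimension of a measure: the infimum of Hausdorff dimensions of Borel sets of full
measure. -/
noncomputable def dimHMeasure {E : Type*} [EMetricSpace E] [MeasurableSpace E]
    (μ : MeasureTheory.Measure E) : ℝ≥0∞ :=
  sInf {s | ∃ B : Set E, MeasurableSet B ∧ μ B = 1 ∧ dimH B = s}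

/-- `ν` is the Bernoulli measure associated to the probability vector `p`: it gives each
cylinder the product of the `p`-weights of its letters. -/
def IsBernoulli {Γ₁ Γ₂ : Type*} [Fintype Γ₁] [Fintype Γ₂] (A : Set (Γ₁ × Γ₂))
    (p : Γ₁ × Γ₂ → ℝ) [MeasurableSpace (ℕ → ↥A)] (ν : MeasureTheory.Measure (ℕ → ↥A)) : Prop :=
  ∀ (m : ℕ) (w : Fin m → ↥A),
    ν {ω | ∀ k : Fin m, ω k.val = w k} = ENNReal.ofReal (∏ k : Fin m, p (w k : Γ₁ × Γ₂))

/-- The symbolic metric `d` on `Λ^ℕ` for a non-linear carpet: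
`d((𝚒₁,𝚓₁),(𝚒₂,𝚓₂)) = max {‖f'_{𝚒₁∧𝚒₂}‖, ‖g'_{𝚓₁∧𝚓₂}‖}`. -/
noncomputable def symbolicDist {Λ₁ Λ₂ : Type*} (F : ConformalIFS Λ₁) (G : ConformalIFS Λ₂)
    (A : Set (Λ₁ × Λ₂)) (ω₁ ω₂ : ℕ → ↥A) : ℝ :=
  max
    (rhoDist (wordDerivNorm F.f F.f')
      (fun k => ((ω₁ k : Λ₁ × Λ₂)).1) (fun k => ((ω₂ k : Λ₁ × Λ₂)).1))
    (rhoDist (wordDerivNorm G.f G.f')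
      (fun k => ((ω₁ k : Λ₁ × Λ₂)).2) (fun k => ((ω₂ k : Λ₁ × Λ₂)).2))

section IFSFacts
variable {Λ : Type*} (F : ConformalIFS Λ)

lemma compWord_mem (w : List Λ) {x : ℝ} (hx : x ∈ Icc (0:ℝ) 1) :
    compWord F.f w x ∈ Icc (0:ℝ) 1 := by
  induction w with
  | nil => exact hx
  | cons i w ih => exact F.mapsTo i ih

lemma compWord_append (f : Λ → ℝ → ℝ) (u v : List Λ) (x : ℝ) :
    compWord f (u ++ v) x = compWord f u (compWord f v x) := by
  induction u with
  | nil => rfl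
  | cons i w ih => simp [compWord, ih]

lemma wordDeriv_append (f f' : Λ → ℝ → ℝ) (u v : List Λ) (x : ℝ) :
    wordDeriv f f' (u ++ v) x = wordDeriv f f' u (compWord f v x) * wordDeriv f f' v x := by
  induction u with
  | nil => simp [wordDeriv]
  | cons i w ih => simp [wordDeriv, ih, compWord_append, mul_assoc]

lemma compWord_contr (w : List Λ) {x y : ℝ} (hx : x ∈ Icc (0:ℝ) 1) (hy : y ∈ Icc (0:ℝ) 1) :
    |compWord F.f w x - compWord F.f w y| ≤ F.ratio ^ w.length := by
  induction w with
  | nil =>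
    simp only [compWord, id, List.length_nil, pow_zero, abs_le]
    constructor <;> linarith [hx.1, hx.2, hy.1, hy.2]
  | cons i w ih =>
    refine (F.contracting i _ (compWord_mem F w hx) _ (compWord_mem F w hy)).trans ?_
    rw [List.length_cons, pow_succ']
    exact mul_le_mul_of_nonneg_left ih F.ratio_pos.le

lemma deriv_le_ratio (i : Λ) {x : ℝ} (hx : x ∈ Icc (0:ℝ) 1) : |F.f' i x| ≤ F.ratio := by
  have h := F.hasDeriv i x hx
  rw [hasDerivWithinAt_iff_tendsto_slope] at h
  have hne : (nhdsWithin x (Icc (0:ℝ) 1 \ {x})).NeBot := by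
    have := (uniqueDiffOn_Icc (zero_lt_one (α := ℝ))) x hx
    have h2 := uniqueDiffWithinAt_iff_accPt.1 this
    rwa [accPt_principal_iff_nhdsWithin] at h2
  refine le_of_tendsto h.abs ?_
  filter_upwards [self_mem_nhdsWithin] with y hy
  rw [slope_def_field, abs_div]
  have : 0 < |y - x| := abs_pos.2 (sub_ne_zero.2 (fun e => hy.2 e))
  rw [div_le_iff₀ this]
  exact F.contracting i y hy.1 x hx

lemma deriv_contOn (i : Λ) : ContinuousOn (F.f' i) (Icc (0:ℝ) 1) := by
  obtain ⟨C, hC⟩ := F.holder i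
  intro x hx
  rw [ContinuousWithinAt, tendsto_iff_dist_tendsto_zero]
  have h1 : Tendsto (fun y : ℝ => C * |y - x| ^ F.exponent) (nhdsWithin x (Icc (0:ℝ) 1)) (nhds 0) := by
    have : ContinuousAt (fun y : ℝ => C * |y - x| ^ F.exponent) x := by
      refine ContinuousAt.mul continuousAt_const ?_
      exact ContinuousAt.rpow_const (by fun_prop) (Or.inr F.exponent_pos.le)
    have h2 := this.tendsto
    simp only [sub_self, abs_zero, Real.zero_rpow F.exponent_pos.ne', mul_zero] at h2
    exact h2.mono_left nhdsWithin_le_nhds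
  refine squeeze_zero' (Eventually.of_forall fun _ => dist_nonneg) ?_ h1
  filter_upwards [self_mem_nhdsWithin] with y hy
  exact hC y hy x hx

lemma deriv_lower [Fintype Λ] : ∃ c : ℝ, 0 < c ∧ c ≤ 1 ∧ ∀ i, ∀ x ∈ Icc (0:ℝ) 1, c ≤ |F.f' i x| := by
  classical
  have h : ∀ i, ∃ c : ℝ, 0 < c ∧ ∀ x ∈ Icc (0:ℝ) 1, c ≤ |F.f' i x| := by
    intro i
    obtain ⟨x0, hx0, hmin⟩ := isCompact_Icc.exists_isMinOn (nonempty_Icc.2 zero_le_one)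
      ((deriv_contOn F i).abs)
    exact ⟨|F.f' i x0|, abs_pos.2 (F.nonvanishing i x0 hx0), fun x hx => hmin hx⟩
  choose c hc0 hc using h
  have : ∀ s : Finset Λ, ∃ d : ℝ, 0 < d ∧ d ≤ 1 ∧ ∀ i ∈ s, d ≤ c i := by
    intro s
    induction s using Finset.induction_on with
    | empty => exact ⟨1, one_pos, le_rfl, by simp⟩
    | insert a s _ ih =>
      obtain ⟨d, h0, h1, h2⟩ := ih
      refine ⟨min d (c a), lt_min h0 (hc0 a), (min_le_left _ _).trans h1, ?_⟩
      intro i hi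
      rcases Finset.mem_insert.1 hi with rfl | hi
      · exact min_le_right _ _
      · exact (min_le_left _ _).trans (h2 i hi)
  obtain ⟨d, h0, h1, h2⟩ := this Finset.univ
  exact ⟨d, h0, h1, fun i x hx => (h2 i (Finset.mem_univ i)).trans (hc i x hx)⟩

lemma holder_unif [Fintype Λ] : ∃ C : ℝ, 0 ≤ C ∧ ∀ i, ∀ x ∈ Icc (0:ℝ) 1, ∀ y ∈ Icc (0:ℝ) 1,
    |F.f' i x - F.f' i y| ≤ C * |x - y| ^ F.exponent := by
  choose C hC using F.holder
  refine ⟨∑ i, |C i|, Finset.sum_nonneg fun _ _ => abs_nonneg _, fun i x hx y hy => ?_⟩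
  refine (hC i x hx y hy).trans ?_
  refine mul_le_mul_of_nonneg_right ?_ (Real.rpow_nonneg (abs_nonneg _) _)
  exact (le_abs_self _).trans
    (Finset.single_le_sum (f := fun i => |C i|) (fun _ _ => abs_nonneg _) (Finset.mem_univ i))

lemma wordDeriv_upper (w : List Λ) {x : ℝ} (hx : x ∈ Icc (0:ℝ) 1) :
    |wordDeriv F.f F.f' w x| ≤ F.ratio ^ w.length := by
  induction w with
  | nil => simp [wordDeriv]
  | cons i w ih =>
    simp only [wordDeriv, abs_mul, List.length_cons, pow_succ']
    exact mul_le_mul (deriv_le_ratio F i (compWord_mem F w hx)) ih (abs_nonneg _) F.ratio_pos.le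

lemma wordDeriv_lower {c : ℝ} (hc0 : 0 < c) (hc : ∀ i, ∀ x ∈ Icc (0:ℝ) 1, c ≤ |F.f' i x|)
    (w : List Λ) {x : ℝ} (hx : x ∈ Icc (0:ℝ) 1) :
    c ^ w.length ≤ |wordDeriv F.f F.f' w x| := by
  induction w with
  | nil => simp [wordDeriv]
  | cons i w ih =>
    simp only [wordDeriv, abs_mul, List.length_cons, pow_succ']
    exact mul_le_mul (hc i _ (compWord_mem F w hx)) ih (by positivity) (abs_nonneg _)

lemma wordDeriv_le_norm (w : List Λ) {x : ℝ} (hx : x ∈ Icc (0:ℝ) 1) :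
    |wordDeriv F.f F.f' w x| ≤ wordDerivNorm F.f F.f' w := by
  refine le_csSup ⟨F.ratio ^ w.length, ?_⟩ ⟨x, hx, rfl⟩
  rintro _ ⟨y, hy, rfl⟩
  exact wordDeriv_upper F w hy

lemma norm_le_of (w : List Λ) {B : ℝ} (h : ∀ x ∈ Icc (0:ℝ) 1, |wordDeriv F.f F.f' w x| ≤ B) :
    wordDerivNorm F.f F.f' w ≤ B := by
  refine csSup_le ⟨_, ⟨0, by simp, rfl⟩⟩ ?_
  rintro _ ⟨y, hy, rfl⟩
  exact h y hy

lemma distortion [Fintype Λ] : ∃ K : ℝ, 1 ≤ K ∧ ∀ w : List Λ, ∀ x ∈ Icc (0:ℝ) 1,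
    ∀ y ∈ Icc (0:ℝ) 1, |wordDeriv F.f F.f' w x| ≤ K * |wordDeriv F.f F.f' w y| := by
  obtain ⟨c, hc0, hc1, hc⟩ := deriv_lower F
  obtain ⟨C, hC0, hC⟩ := holder_unif F
  set θ : ℝ := F.ratio ^ F.exponent with hθ
  have hθ0 : 0 ≤ θ := Real.rpow_nonneg F.ratio_pos.le _
  have hθ1 : θ < 1 := Real.rpow_lt_one F.ratio_pos.le F.ratio_lt_one F.exponent_pos
  have key : ∀ w : List Λ, ∀ x ∈ Icc (0:ℝ) 1, ∀ y ∈ Icc (0:ℝ) 1, |wordDeriv F.f F.f' w x| ≤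
      Real.exp ((C / c) * ∑ k ∈ Finset.range w.length, θ ^ k) * |wordDeriv F.f F.f' w y| := by
    intro w x hx y hy
    induction w with
    | nil => simp [wordDeriv]
    | cons i w ih =>
      simp only [wordDeriv, abs_mul, List.length_cons, Finset.sum_range_succ, mul_add, Real.exp_add]
      have hX := compWord_mem F w hx
      have hY := compWord_mem F w hy
      have hcy := hc i _ hY
      have h1 : |F.f' i (compWord F.f w x)| ≤
          Real.exp (C / c * θ ^ w.length) * |F.f' i (compWord F.f w y)| := by
        have h2 := hC i _ hX _ hY
        have h3 : |compWord F.f w x - compWord F.f w y| ^ F.exponent ≤ θ ^ w.length := by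
          refine (Real.rpow_le_rpow (abs_nonneg _) (compWord_contr F w hx hy) F.exponent_pos.le).trans ?_
          rw [hθ, ← Real.rpow_natCast, ← Real.rpow_natCast, ← Real.rpow_mul F.ratio_pos.le,
            ← Real.rpow_mul F.ratio_pos.le, mul_comm]
        have h4 : |F.f' i (compWord F.f w x)| ≤ |F.f' i (compWord F.f w y)| + C * θ ^ w.length := by
          have := abs_sub_abs_le_abs_sub (F.f' i (compWord F.f w x)) (F.f' i (compWord F.f w y))
          have := mul_le_mul_of_nonneg_left h3 hC0
          linarith
        have h5 : C * θ ^ w.length ≤ C / c * θ ^ w.length * |F.f' i (compWord F.f w y)| := by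
          have : C * θ ^ w.length = C / c * θ ^ w.length * c := by field_simp
          rw [this]
          exact mul_le_mul_of_nonneg_left hcy (by positivity)
        have h6 := Real.add_one_le_exp (C / c * θ ^ w.length)
        have h7 := mul_le_mul_of_nonneg_right h6 (abs_nonneg (F.f' i (compWord F.f w y)))
        linarith
      calc _ ≤ _ := mul_le_mul h1 ih (abs_nonneg _) (by positivity)
        _ = _ := by ring
  refine ⟨Real.exp ((C / c) * (1 - θ)⁻¹), Real.one_le_exp ?_, fun w x hx y hy => ?_⟩
  · have : 0 < 1 - θ := by linarith
    positivity
  · refine (key w x hx y hy).trans ?_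
    gcongr
    have h := summable_geometric_of_lt_one hθ0 hθ1
    rw [← tsum_geometric_of_lt_one hθ0 hθ1]
    exact h.sum_le_tsum _ (fun _ _ => by positivity)

/-- The only facts about the norms of word derivatives used below. -/
structure NormFacts (N : List Λ → ℝ) (ρ K c : ℝ) : Prop where
  ρ0 : 0 < ρ
  ρ1 : ρ < 1
  K1 : 1 ≤ K
  c0 : 0 < c
  c1 : c ≤ 1
  lower : ∀ w, c ^ w.length ≤ N w
  upper : ∀ w, N w ≤ ρ ^ w.length
  submul : ∀ u v, N (u ++ v) ≤ N u * N v
  supmul : ∀ u v, N u * N v ≤ K * N (u ++ v)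

lemma NormFacts.pos {N : List Λ → ℝ} {ρ K c : ℝ} (h : NormFacts N ρ K c) (w) : 0 < N w :=
  (pow_pos h.c0 _).trans_le (h.lower w)

lemma NormFacts.le_one {N : List Λ → ℝ} {ρ K c : ℝ} (h : NormFacts N ρ K c) (w) : N w ≤ 1 :=
  (h.upper w).trans (pow_le_one₀ h.ρ0.le h.ρ1.le)

lemma ifs_facts [Fintype Λ] : ∃ ρ K c : ℝ, NormFacts (wordDerivNorm F.f F.f') ρ K c := by
  obtain ⟨c, hc0, hc1, hc⟩ := deriv_lower F
  obtain ⟨K, hK1, hK⟩ := distortion F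
  have z : (0:ℝ) ∈ Icc (0:ℝ) 1 := by simp
  refine ⟨F.ratio, K, c, F.ratio_pos, F.ratio_lt_one, hK1, hc0, hc1, ?_, ?_, ?_, ?_⟩
  · exact fun w => (wordDeriv_lower F hc0 hc w z).trans (wordDeriv_le_norm F w z)
  · exact fun w => norm_le_of F w fun x hx => wordDeriv_upper F w hx
  · intro u v
    refine norm_le_of F _ fun x hx => ?_
    rw [wordDeriv_append, abs_mul]
    exact mul_le_mul (wordDeriv_le_norm F u (compWord_mem F v hx)) (wordDeriv_le_norm F v hx)
      (abs_nonneg _) ((abs_nonneg _).trans (wordDeriv_le_norm F u z))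
  · intro u v
    have hu0 : 0 < wordDerivNorm F.f F.f' u :=
      (pow_pos hc0 _).trans_le ((wordDeriv_lower F hc0 hc u z).trans (wordDeriv_le_norm F u z))
    rw [mul_comm, ← le_div_iff₀ hu0]
    refine norm_le_of F _ fun x hx => ?_
    rw [le_div_iff₀ hu0]
    have h1 : wordDerivNorm F.f F.f' u ≤ K * |wordDeriv F.f F.f' u (compWord F.f v x)| :=
      norm_le_of F _ fun y hy => hK u y hy _ (compWord_mem F v hx)
    have h2 := wordDeriv_le_norm F (u ++ v) hx
    rw [wordDeriv_append, abs_mul] at h2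
    calc _ ≤ |wordDeriv F.f F.f' v x| * (K * |wordDeriv F.f F.f' u (compWord F.f v x)|) :=
          mul_le_mul_of_nonneg_left h1 (abs_nonneg _)
      _ = K * (|wordDeriv F.f F.f' u (compWord F.f v x)| * |wordDeriv F.f F.f' v x|) := by ring
      _ ≤ _ := mul_le_mul_of_nonneg_left h2 (by linarith)

end IFSFacts

section Rho
variable {Γ : Type*}

/-- The prefix of length `n` of a sequence. -/
def pref (u : ℕ → Γ) (n : ℕ) : List Γ := List.ofFn fun k : Fin n => u k.val

lemma rhoDist_self (val : List Γ → ℝ) (u : ℕ → Γ) : rhoDist val u u = 0 := by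
  simp [rhoDist]

lemma rhoDist_ne (val : List Γ → ℝ) {u v : ℕ → Γ} (h : u ≠ v) :
    ∃ M, (∀ k < M, u k = v k) ∧ u M ≠ v M ∧ rhoDist val u v = val (pref u M) := by
  classical
  refine ⟨Nat.find (Function.ne_iff.mp h), ?_, Nat.find_spec (Function.ne_iff.mp h), ?_⟩
  · intro k hk
    by_contra hc
    exact Nat.find_min _ hk hc
  · unfold rhoDist pref
    simp only [dif_neg h]

lemma pref_length (u : ℕ → Γ) (n : ℕ) : (pref u n).length = n := by simp [pref]

lemma pref_add (u : ℕ → Γ) (m n : ℕ) : pref u (m + n) = pref u m ++ pref (fun k => u (m + k)) n := by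
  simp [pref, List.ofFn_add]

/-- Regrouping a sequence in blocks of length `n`. -/
def blk (n : ℕ) (u : ℕ → Γ) : ℕ → (Fin n → Γ) := fun k l => u (k * n + l.val)

lemma blk_eq {n : ℕ} {u v : ℕ → Γ} {k : ℕ} :
    blk n u k = blk n v k ↔ ∀ l < n, u (k * n + l) = v (k * n + l) := by
  constructor
  · intro h l hl
    exact congrFun h ⟨l, hl⟩
  · intro h
    funext l
    exact h l l.2

lemma blk_injective {n : ℕ} (hn : 0 < n) : Function.Injective (blk (Γ := Γ) n) := by
  intro u v h
  funext k
  have := blk_eq.1 (congrFun h (k / n)) (k % n) (Nat.mod_lt _ hn)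
  rwa [Nat.div_add_mod'] at this

lemma map_prod_pref (a : Γ → ℝ) (u : ℕ → Γ) (Q : ℕ) :
    ((pref u Q).map a).prod = ∏ k ∈ Finset.range Q, a (u k) := by
  simp [pref, List.map_ofFn, List.prod_ofFn, Finset.prod_range]

variable {N : List Γ → ℝ} {ρ K c : ℝ}

lemma block_lower (hN : NormFacts N ρ K c) (n : ℕ) (u : ℕ → Γ) (Q : ℕ) :
    N (pref u (Q * n)) ≤ ∏ k ∈ Finset.range Q, N (List.ofFn (blk n u k)) := by
  induction Q with
  | zero => simpa [pref] using hN.le_one []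
  | succ Q ih =>
    rw [Nat.succ_mul, pref_add, Finset.prod_range_succ]
    refine (hN.submul _ _).trans ?_
    exact mul_le_mul_of_nonneg_right ih (hN.pos _).le

lemma block_upper (hN : NormFacts N ρ K c) (n : ℕ) (u : ℕ → Γ) (Q : ℕ) :
    ∏ k ∈ Finset.range Q, N (List.ofFn (blk n u k)) ≤ K ^ Q * N (pref u (Q * n)) := by
  induction Q with
  | zero => simpa [pref] using hN.lower []
  | succ Q ih =>
    rw [Nat.succ_mul, pref_add, Finset.prod_range_succ]
    have hK0 : 0 < K := by linarith [hN.K1]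
    calc _ ≤ K ^ Q * N (pref u (Q * n)) * N (List.ofFn (blk n u Q)) :=
          mul_le_mul_of_nonneg_right ih (hN.pos _).le
      _ = K ^ Q * (N (pref u (Q * n)) * N (List.ofFn (blk n u Q))) := by ring
      _ ≤ K ^ Q * (K * N (pref u (Q * n) ++ List.ofFn (blk n u Q))) :=
          mul_le_mul_of_nonneg_left (hN.supmul _ _) (by positivity)
      _ = _ := by
          have e : List.ofFn (blk n u Q) = pref (fun k => u (Q * n + k)) n := rfl
          rw [e, pow_succ]; ring

/-- first disagreement of block sequences -/
lemma rho_block {n : ℕ} (hn : 0 < n) {u v : ℕ → Γ} (h : u ≠ v) :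
    ∃ Q r, r < n ∧ rhoDist N u v = N (pref u (Q * n + r)) ∧
      rhoDist (fun L => (L.map (fun i : Fin n → Γ => N (List.ofFn i))).prod) (blk n u) (blk n v)
        = ∏ k ∈ Finset.range Q, N (List.ofFn (blk n u k)) := by
  obtain ⟨M, h1, h2, h3⟩ := rhoDist_ne N h
  obtain ⟨Q, g1, g2, g3⟩ := rhoDist_ne
    (fun L => (L.map (fun i : Fin n → Γ => N (List.ofFn i))).prod) ((blk_injective hn).ne h)
  rw [map_prod_pref] at g3
  have hQ : Q = M / n := by
    refine le_antisymm ?_ ?_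
    · by_contra! hlt
      have := blk_eq.1 (g1 _ hlt) (M % n) (Nat.mod_lt _ hn)
      rw [Nat.div_add_mod'] at this
      exact h2 this
    · by_contra! hlt
      apply g2
      rw [blk_eq]
      intro l hl
      apply h1
      have : (Q + 1) * n ≤ M := (Nat.le_div_iff_mul_le hn).1 hlt
      nlinarith
  refine ⟨Q, M % n, Nat.mod_lt _ hn, ?_, g3⟩
  rw [h3, hQ, Nat.div_add_mod']

lemma rho_le_block (hN : NormFacts N ρ K c) {n : ℕ} (hn : 0 < n) (u v : ℕ → Γ) :
    rhoDist N u v ≤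
      rhoDist (fun L => (L.map (fun i : Fin n → Γ => N (List.ofFn i))).prod) (blk n u) (blk n v) := by
  by_cases h : u = v
  · subst h; simp [rhoDist_self]
  obtain ⟨Q, r, hr, e1, e2⟩ := rho_block hn h
  rw [e1, e2, pref_add]
  refine (hN.submul _ _).trans ((mul_le_of_le_one_right (hN.pos _).le (hN.le_one _)).trans ?_)
  exact block_lower hN n u Q

lemma block_le_rho (hN : NormFacts N ρ K c) {ε : ℝ} (hε : 0 < ε) (hε1 : ε < 1) :
    ∀ᶠ n : ℕ in atTop, ∃ C : ℝ, 0 ≤ C ∧ ∀ u v : ℕ → Γ,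
      rhoDist (fun L => (L.map (fun i : Fin n → Γ => N (List.ofFn i))).prod) (blk n u) (blk n v)
        ≤ C * (rhoDist N u v) ^ (1 - ε) := by
  have hK0 : 0 < K := by linarith [hN.K1]
  have hlim : Tendsto (fun n : ℕ => (ρ ^ ε) ^ n) atTop (nhds 0) :=
    tendsto_pow_atTop_nhds_zero_of_lt_one (Real.rpow_nonneg hN.ρ0.le _)
      (Real.rpow_lt_one hN.ρ0.le hN.ρ1 hε)
  have hev := hlim.eventually (gt_mem_nhds (inv_pos.2 hK0))
  filter_upwards [hev, eventually_gt_atTop 0] with n hn hn0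
  have hcn : 0 < c ^ n := pow_pos hN.c0 n
  refine ⟨(K / c ^ n) ^ (1 - ε), Real.rpow_nonneg (by positivity) _, fun u v => ?_⟩
  by_cases h : u = v
  · subst h
    rw [rhoDist_self, rhoDist_self, Real.zero_rpow (by linarith), mul_zero]
  obtain ⟨Q, r, hr, e1, e2⟩ := rho_block hn0 h
  rw [e1, e2]
  refine (block_upper hN n u Q).trans ?_
  have hp := hN.pos (pref u (Q * n))
  have hp2 := hN.pos (pref u (Q * n + r))
  -- `K ^ Q * P ^ ε ≤ 1`
  have s1 : K ^ Q * N (pref u (Q * n)) ^ ε ≤ 1 := by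
    have h1 : N (pref u (Q * n)) ^ ε ≤ ((ρ ^ ε) ^ n) ^ Q := by
      have := hN.upper (pref u (Q * n))
      rw [pref_length] at this
      refine (Real.rpow_le_rpow hp.le this hε.le).trans (le_of_eq ?_)
      rw [← pow_mul, ← Real.rpow_natCast, ← Real.rpow_natCast, ← Real.rpow_mul hN.ρ0.le,
        ← Real.rpow_mul hN.ρ0.le]
      congr 1
      push_cast; ring
    have h2 : ((ρ ^ ε) ^ n) ^ Q ≤ (K⁻¹) ^ Q :=
      pow_le_pow_left₀ (pow_nonneg (Real.rpow_nonneg hN.ρ0.le _) _) hn.le Q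
    calc _ ≤ K ^ Q * (K⁻¹) ^ Q := mul_le_mul_of_nonneg_left (h1.trans h2) (by positivity)
      _ = 1 := by rw [← mul_pow, mul_inv_cancel₀ hK0.ne', one_pow]
  have s2 : K ^ Q * N (pref u (Q * n)) ≤ N (pref u (Q * n)) ^ (1 - ε) := by
    have e : N (pref u (Q * n)) = N (pref u (Q * n)) ^ ε * N (pref u (Q * n)) ^ (1 - ε) := by
      rw [← Real.rpow_add hp]; simp
    calc K ^ Q * N (pref u (Q * n))
        = K ^ Q * N (pref u (Q * n)) ^ ε * N (pref u (Q * n)) ^ (1 - ε) := by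
          conv_lhs => rw [e]
          ring
      _ ≤ 1 * N (pref u (Q * n)) ^ (1 - ε) :=
          mul_le_mul_of_nonneg_right s1 (Real.rpow_nonneg hp.le _)
      _ = _ := one_mul _
  refine s2.trans ?_
  rw [← Real.mul_rpow (by positivity) hp2.le]
  refine Real.rpow_le_rpow hp.le ?_ (by linarith)
  have h3 := hN.supmul (pref u (Q * n)) (pref (fun k => u (Q * n + k)) r)
  rw [← pref_add] at h3
  have h4 : c ^ n ≤ N (pref (fun k => u (Q * n + k)) r) := by
    refine le_trans ?_ (hN.lower _)
    rw [pref_length]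
    exact pow_le_pow_of_le_one hN.c0.le hN.c1 hr.le
  rw [div_mul_eq_mul_div, le_div_iff₀ hcn]
  exact (mul_le_mul_of_nonneg_left h4 hp.le).trans h3

end Rho

section Mass

lemma mass_dist {X : Type*} [EMetricSpace X] (m : OuterMeasure X) (E : Set X) (hE : m E ≠ 0)
    {s : ℝ} (hs : 0 < s) {δ : ℝ} (hδ : 0 < δ)
    (h : ∀ x ∈ E, ∀ r : ℝ, 0 < r → r < δ →
      m {y | edist x y ≤ ENNReal.ofReal r} ≤ ENNReal.ofReal (r ^ s)) :
    ENNReal.ofReal s ≤ dimH E := by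
  borelize X
  refine le_dimH_of_hausdorffMeasure_ne_zero (d := s.toNNReal) ?_
  rw [Real.coe_toNNReal _ hs.le]
  suffices hm : m E ≤ Measure.hausdorffMeasure s E by
    intro h0
    rw [h0] at hm
    exact hE (le_antisymm hm bot_le)
  rw [Measure.hausdorffMeasure_apply]
  refine le_trans ?_ (le_iSup₂ (ENNReal.ofReal (δ / 2)) (by simpa using hδ))
  refine le_iInf fun t => le_iInf fun hcov => le_iInf fun hdiam => ?_
  have h1 : m E ≤ ∑' n, m (t n ∩ E) := by
    refine le_trans (m.mono ?_) (measure_iUnion_le _)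
    intro x hx
    obtain ⟨n, hn⟩ := mem_iUnion.1 (hcov hx)
    exact mem_iUnion.2 ⟨n, hn, hx⟩
  refine h1.trans (ENNReal.tsum_le_tsum fun n => ?_)
  rcases (t n ∩ E).eq_empty_or_nonempty with h0 | ⟨x, hx, hxE⟩
  · simp [h0]
  refine le_trans ?_ (le_iSup _ ⟨x, hx⟩)
  have hfin : ediam (t n) ≠ ⊤ := ne_top_of_le_ne_top ENNReal.ofReal_ne_top (hdiam n)
  set d := (ediam (t n)).toReal with hd
  have hdd : ediam (t n) = ENNReal.ofReal d := (ENNReal.ofReal_toReal hfin).symm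
  have hd0 : 0 ≤ d := ENNReal.toReal_nonneg
  have hdδ : d < δ := by
    have := ENNReal.toReal_mono ENNReal.ofReal_ne_top (hdiam n)
    rw [ENNReal.toReal_ofReal (by linarith)] at this
    linarith
  rw [hdd, ENNReal.ofReal_rpow_of_nonneg hd0 hs.le]
  have hcont : Tendsto (fun r : ℝ => ENNReal.ofReal (r ^ s)) (nhdsWithin d (Ioi d))
      (nhds (ENNReal.ofReal (d ^ s))) := by
    refine ENNReal.tendsto_ofReal ?_
    have : ContinuousAt (fun r : ℝ => r ^ s) d := Real.continuousAt_rpow_const _ _ (Or.inr hs.le)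
    exact this.tendsto.mono_left nhdsWithin_le_nhds
  refine ge_of_tendsto hcont ?_
  filter_upwards [self_mem_nhdsWithin, nhdsWithin_le_nhds (Iio_mem_nhds hdδ)] with r hr1 hr2
  refine le_trans (m.mono ?_) (h x hxE r (hd0.trans_lt hr1) hr2)
  intro y hy
  refine (edist_le_ediam_of_mem hx hy.1).trans ?_
  rw [hdd]
  exact ENNReal.ofReal_le_ofReal (le_of_lt hr1)

end Mass

section Asymp

/-- first index at which `T` reaches `t` -/
def fhit (T : ℕ → ℝ) (t : ℝ) : ℕ := sInf {m | t ≤ T m}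

lemma fhit_lt {T : ℕ → ℝ} {t : ℝ} {k : ℕ} (h : k < fhit T t) : T k < t := by
  have := Nat.notMem_of_lt_sInf h
  simpa using this

variable {T : ℕ → ℝ} {χ C : ℝ}

lemma tendsto_of_avg (hχ : 0 < χ) (h : Tendsto (fun n : ℕ => T n / n) atTop (nhds χ)) :
    Tendsto T atTop atTop := by
  have h2 := h.pos_mul_atTop hχ (tendsto_natCast_atTop_atTop (R := ℝ))
  refine h2.congr' ?_
  filter_upwards [eventually_gt_atTop 0] with n hn
  have : (n : ℝ) ≠ 0 := by positivity
  field_simp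

lemma le_fhit (hχ : 0 < χ) (h : Tendsto (fun n : ℕ => T n / n) atTop (nhds χ)) (t : ℝ) :
    t ≤ T (fhit T t) := by
  have hne : {m | t ≤ T m}.Nonempty := ((tendsto_of_avg hχ h).eventually_ge_atTop t).exists
  exact Nat.sInf_mem hne

lemma fhit_asymp (hχ : 0 < χ) (h : Tendsto (fun n : ℕ => T n / n) atTop (nhds χ))
    (hT0 : T 0 = 0) (hC : 0 < C) (hT : ∀ n, T (n + 1) ≤ T n + C) :
    Tendsto (fun t : ℝ => fhit T t) atTop atTop ∧
    Tendsto (fun t : ℝ => (fhit T t : ℝ) / t) atTop (nhds (1 / χ)) := by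
  have hlin : ∀ n : ℕ, T n ≤ C * n := by
    intro n
    induction n with
    | zero => simp [hT0]
    | succ n ih => push_cast; linarith [hT n]
  have hlow := le_fhit hχ h
  have hcast : Tendsto (fun t : ℝ => (fhit T t : ℝ)) atTop atTop := by
    refine tendsto_atTop_mono (f := fun t : ℝ => t / C) (fun t => ?_)
      (tendsto_id.atTop_div_const hC)
    rw [div_le_iff₀ hC, mul_comm]
    exact (hlow t).trans (hlin _)
  have hL : Tendsto (fun t : ℝ => fhit T t) atTop atTop := tendsto_natCast_atTop_iff.1 hcast
  refine ⟨hL, ?_⟩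
  have h1 : Tendsto (fun t : ℝ => T (fhit T t) / t) atTop (nhds 1) := by
    have hu : Tendsto (fun t : ℝ => 1 + C / t) atTop (nhds 1) := by
      have := (tendsto_const_nhds (x := (1:ℝ))).add ((tendsto_const_nhds (x := C)).div_atTop
        (tendsto_id (α := ℝ)))
      simpa using this
    refine tendsto_of_tendsto_of_tendsto_of_le_of_le' tendsto_const_nhds hu ?_ ?_
    · filter_upwards [eventually_gt_atTop 0] with t ht
      rw [le_div_iff₀ ht, one_mul]
      exact hlow t
    · filter_upwards [eventually_gt_atTop 0, hL.eventually_gt_atTop 0] with t ht hpos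
      rw [div_le_iff₀ ht]
      have e : (1 + C / t) * t = t + C := by field_simp
      rw [e]
      have h3 := hT (fhit T t - 1)
      rw [Nat.sub_add_cancel hpos] at h3
      have h4 := fhit_lt (T := T) (t := t) (k := fhit T t - 1) (by omega)
      linarith
  have h2 : Tendsto (fun t : ℝ => T (fhit T t) / (fhit T t : ℝ)) atTop (nhds χ) := h.comp hL
  have h3 := h1.div h2 hχ.ne'
  refine h3.congr' ?_
  filter_upwards [eventually_gt_atTop 0, hL.eventually_gt_atTop 0,
    (h2.eventually (lt_mem_nhds hχ))] with t ht hpos hTp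
  have hp : (0:ℝ) < fhit T t := by exact_mod_cast hpos
  have : 0 < T (fhit T t) := by
    rcases (div_pos_iff.1 hTp) with h | h
    · exact h.1
    · linarith [h.2]
  simp only [Pi.div_apply]
  field_simp

lemma comp_asymp {A : ℕ → ℝ} {a ℓ : ℝ} {L : ℝ → ℕ} (hA : Tendsto (fun n : ℕ => A n / n) atTop (nhds a))
    (hL : Tendsto L atTop atTop) (hL2 : Tendsto (fun t : ℝ => (L t : ℝ) / t) atTop (nhds ℓ)) :
    Tendsto (fun t : ℝ => A (L t) / t) atTop (nhds (a * ℓ)) := by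
  refine ((hA.comp hL).mul hL2).congr' ?_
  filter_upwards [hL.eventually_gt_atTop 0] with t h
  have hp : (0:ℝ) < L t := by exact_mod_cast h
  simp only [Function.comp]
  field_simp

lemma rate_asymp {T1 T2 Ap Aq : ℕ → ℝ} {χ1 χ2 hp hq : ℝ} (h1 : 0 < χ1) (h12 : χ1 ≤ χ2) (hC : 0 < C)
    (t1 : Tendsto (fun n : ℕ => T1 n / n) atTop (nhds χ1))
    (t2 : Tendsto (fun n : ℕ => T2 n / n) atTop (nhds χ2))
    (ap : Tendsto (fun n : ℕ => Ap n / n) atTop (nhds hp))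
    (aq : Tendsto (fun n : ℕ => Aq n / n) atTop (nhds hq))
    (z1 : T1 0 = 0) (z2 : T2 0 = 0)
    (c1 : ∀ n, T1 (n + 1) ≤ T1 n + C) (c2 : ∀ n, T2 (n + 1) ≤ T2 n + C) :
    Tendsto (fun t : ℝ => (Ap (min (fhit T1 t) (fhit T2 t)) + (Aq (fhit T1 t) -
      Aq (min (fhit T1 t) (fhit T2 t)))) / t) atTop (nhds (hq / χ1 + (hp - hq) / χ2)) := by
  obtain ⟨a1, b1⟩ := fhit_asymp h1 t1 z1 hC c1
  obtain ⟨a2, b2⟩ := fhit_asymp (h1.trans_le h12) t2 z2 hC c2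
  have am : Tendsto (fun t : ℝ => min (fhit T1 t) (fhit T2 t)) atTop atTop :=
    tendsto_atTop.2 fun n => by
      filter_upwards [a1.eventually_ge_atTop n, a2.eventually_ge_atTop n] with t x y
      exact le_min x y
  have bm : Tendsto (fun t : ℝ => ((min (fhit T1 t) (fhit T2 t) : ℕ) : ℝ) / t) atTop
      (nhds (1 / χ2)) := by
    have := b1.min b2
    rw [min_eq_right (one_div_le_one_div_of_le h1 h12)] at this
    refine this.congr' ?_
    filter_upwards [eventually_gt_atTop 0] with t ht
    rw [Nat.cast_min, min_div_div_right ht.le]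
  have e1 := comp_asymp ap am bm
  have e2 := comp_asymp aq a1 b1
  have e3 := comp_asymp aq am bm
  have e := e1.add (e2.sub e3)
  have : hp * (1 / χ2) + (hq * (1 / χ1) - hq * (1 / χ2)) = hq / χ1 + (hp - hq) / χ2 := by ring
  rw [this] at e
  refine e.congr fun t => ?_
  ring

end Asymp

section Bernoulli
variable {S : Type*} [Fintype S]

lemma exists_bernoulli (p : S → ℝ) (hp0 : ∀ s, 0 ≤ p s) (hp1 : ∑ s, p s = 1) :
    letI : MeasurableSpace S := ⊤
    ∃ μ : Measure (ℕ → S), IsProbabilityMeasure μ ∧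
      (∀ (n : ℕ) (B : ℕ → Set S), μ {ω | ∀ k < n, ω k ∈ B k} =
        ∏ k ∈ Finset.range n, ENNReal.ofReal (∑ s, (B k).indicator p s)) ∧
      (∀ φ : S → ℝ, ∀ᵐ ω ∂μ, Tendsto (fun n : ℕ => (∑ k ∈ Finset.range n, φ (ω k)) / n) atTop
        (nhds (∑ s, p s * φ s))) := by
  letI : MeasurableSpace S := ⊤
  haveI : DiscreteMeasurableSpace S := ⟨fun _ => trivial⟩
  have hsum : ∑ s, ENNReal.ofReal (p s) = 1 := by
    rw [← ENNReal.ofReal_sum_of_nonneg (fun s _ => hp0 s), hp1, ENNReal.ofReal_one]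
  let P : PMF S := PMF.ofFintype (fun s => ENNReal.ofReal (p s)) hsum
  let ν : Measure S := P.toMeasure
  haveI : IsProbabilityMeasure ν := PMF.toMeasure.isProbabilityMeasure P
  let μ : Measure (ℕ → S) := Measure.infinitePi (fun _ : ℕ => ν)
  refine ⟨μ, inferInstance, ?_, ?_⟩
  · intro n B
    have e : {ω : ℕ → S | ∀ k < n, ω k ∈ B k} = Set.pi (Finset.range n : Set ℕ) B := by
      ext ω; simp [Set.mem_pi]
    rw [e, Measure.infinitePi_pi _ (fun _ _ => MeasurableSet.of_discrete)]
    refine Finset.prod_congr rfl fun k _ => ?_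
    rw [PMF.toMeasure_apply_fintype]
    rw [ENNReal.ofReal_sum_of_nonneg (fun s _ => Set.indicator_nonneg (fun s _ => hp0 s) s)]
    refine Finset.sum_congr rfl fun s _ => ?_
    by_cases hs : s ∈ B k <;> simp [hs, P, PMF.ofFintype_apply]
  · intro φ
    have hφ : Measurable φ := measurable_of_finite φ
    have hmap : ∀ i : ℕ, Measure.map (fun ω : ℕ → S => ω i) μ = ν := fun i =>
      Measure.infinitePi_map_eval (fun _ : ℕ => ν) i
    have hinteg : Integrable φ ν := Integrable.of_finite
    have hmean : ∫ ω, φ (ω 0) ∂μ = ∑ s, p s * φ s := by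
      have h1 : ∫ ω, φ (ω 0) ∂μ = ∫ s, φ s ∂ν := by
        conv_rhs => rw [← hmap 0]
        rw [integral_map (measurable_pi_apply 0).aemeasurable hφ.aestronglyMeasurable]
      rw [h1, PMF.integral_eq_sum]
      refine Finset.sum_congr rfl fun s _ => ?_
      simp [P, PMF.ofFintype_apply, ENNReal.toReal_ofReal (hp0 s)]
    have key := ProbabilityTheory.strong_law_ae_real (μ := μ) (fun i ω => φ (ω i)) ?_ ?_ ?_
    · rw [hmean] at key
      exact key
    · have : Integrable φ (Measure.map (fun ω : ℕ → S => ω 0) μ) := by rw [hmap 0]; exact hinteg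
      exact this.comp_measurable (measurable_pi_apply 0)
    · intro i j hij
      have h := ProbabilityTheory.iIndepFun_infinitePi (P := fun _ : ℕ => ν)
        (X := fun _ => φ) (fun _ => hφ)
      exact h.indepFun hij
    · intro i
      refine ⟨(hφ.comp (measurable_pi_apply i)).aemeasurable,
        (hφ.comp (measurable_pi_apply 0)).aemeasurable, ?_⟩
      have : ∀ j, Measure.map (fun ω : ℕ → S => φ (ω j)) μ = Measure.map φ ν := by
        intro j
        rw [← hmap j, Measure.map_map hφ (measurable_pi_apply j)]
        rfl
      rw [this, this]

end Bernoulli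

section Lower
variable {S Γ : Type*} [Fintype S]

/-- marginal of a weight vector -/
def marg (π : S → Γ) (p : S → ℝ) (i : Γ) : ℝ := ∑ s, (π ⁻¹' {i}).indicator p s

lemma marg_nonneg (π : S → Γ) {p : S → ℝ} (hp : ∀ s, 0 ≤ p s) (i : Γ) : 0 ≤ marg π p i :=
  Finset.sum_nonneg fun s _ => Set.indicator_nonneg (fun s _ => hp s) s

/-- the function `g₁` in abstract form -/
def gAbs (π : S → Γ) (α β : S → ℝ) (p : S → ℝ) : ℝ :=
  (∑ s, p s * (-Real.log (marg π p (π s)))) / (∑ s, p s * α s) +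
    ((∑ s, p s * (-Real.log (p s))) - ∑ s, p s * (-Real.log (marg π p (π s)))) / (∑ s, p s * β s)

lemma ball_meas_le (μ : Measure[MeasurableSpace.pi (m := fun _ : ℕ => (⊤ : MeasurableSpace S))] (ℕ → S))
    (π : S → Γ) (p : S → ℝ) (hp0 : ∀ s, 0 ≤ p s)
    (hμ : ∀ (n : ℕ) (B : ℕ → Set S), μ {ω | ∀ k < n, ω k ∈ B k} =
        ∏ k ∈ Finset.range n, ENNReal.ofReal (∑ s, (B k).indicator p s))
    (ω : ℕ → S) (L m : ℕ) (hm : m ≤ L) :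
    μ {y | (∀ k < m, y k = ω k) ∧ ∀ k < L, π (y k) = π (ω k)} ≤
      ENNReal.ofReal (Real.exp (-(∑ k ∈ Finset.range m, (-Real.log (p (ω k))) +
        (∑ k ∈ Finset.range L, (-Real.log (marg π p (π (ω k)))) -
          ∑ k ∈ Finset.range m, (-Real.log (marg π p (π (ω k)))))))) := by
  classical
  let B : ℕ → Set S := fun k => if k < m then {ω k} else π ⁻¹' {π (ω k)}
  have hsub : {y : ℕ → S | (∀ k < m, y k = ω k) ∧ ∀ k < L, π (y k) = π (ω k)} ⊆
      {y | ∀ k < L, y k ∈ B k} := by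
    rintro y ⟨h1, h2⟩ k hk
    by_cases hkm : k < m
    · simp [B, hkm, h1 k hkm]
    · simp [B, hkm, h2 k hk]
  refine (measure_mono hsub).trans ?_
  rw [hμ, ← ENNReal.ofReal_prod_of_nonneg
    (fun k _ => Finset.sum_nonneg fun s _ => Set.indicator_nonneg (fun s _ => hp0 s) s)]
  refine ENNReal.ofReal_le_ofReal ?_
  let φ : ℕ → ℝ := fun k => if k < m then Real.log (p (ω k)) else Real.log (marg π p (π (ω k)))
  have h1 : ∏ k ∈ Finset.range L, (∑ s, (B k).indicator p s) ≤
      ∏ k ∈ Finset.range L, Real.exp (φ k) := by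
    refine Finset.prod_le_prod
      (fun k _ => Finset.sum_nonneg fun s _ => Set.indicator_nonneg (fun s _ => hp0 s) s) ?_
    intro k _
    by_cases hkm : k < m
    · have : ∑ s, (B k).indicator p s = p (ω k) := by
        simp [B, hkm, Set.indicator_apply]
      rw [this]
      simp only [φ, hkm, if_true]
      exact Real.le_exp_log _
    · have : ∑ s, (B k).indicator p s = marg π p (π (ω k)) := by
        simp only [B, hkm, if_false]; rfl
      rw [this]
      simp only [φ, hkm, if_false]
      exact Real.le_exp_log _
  refine h1.trans (le_of_eq ?_)
  rw [← Real.exp_sum]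
  congr 1
  have e1 : ∀ k, φ k = Real.log (marg π p (π (ω k))) +
      (if k < m then Real.log (p (ω k)) - Real.log (marg π p (π (ω k))) else 0) := by
    intro k
    by_cases hkm : k < m <;> simp [φ, hkm]
  have e2 : (Finset.range L).filter (fun k => k < m) = Finset.range m := by
    ext k; simp; omega
  rw [Finset.sum_congr rfl (fun k _ => e1 k), Finset.sum_add_distrib, ← Finset.sum_filter, e2,
    Finset.sum_sub_distrib]
  simp only [Finset.sum_neg_distrib]
  ring

theorem lower_bound [EMetricSpace (ℕ → S)] (π : S → Γ) (α β : S → ℝ)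
    (hα : ∀ s, 0 < α s) (hβ : ∀ s, 0 < β s)
    (H1 : ∀ (ω ω' : ℕ → S) (m : ℕ),
      edist ω ω' < ENNReal.ofReal (Real.exp (-∑ k ∈ Finset.range m, α (ω k))) → π (ω' m) = π (ω m))
    (H2 : ∀ (ω ω' : ℕ → S) (m : ℕ),
      edist ω ω' < ENNReal.ofReal (Real.exp (-∑ k ∈ Finset.range m, α (ω k))) →
      edist ω ω' < ENNReal.ofReal (Real.exp (-∑ k ∈ Finset.range m, β (ω k))) → ω' m = ω m)
    (p : S → ℝ) (hp0 : ∀ s, 0 ≤ p s) (hp1 : ∑ s, p s = 1)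
    (hle : ∑ s, p s * α s ≤ ∑ s, p s * β s) :
    ENNReal.ofReal (gAbs π α β p) ≤ dimH (univ : Set (ℕ → S)) := by
  classical
  suffices hmain : ∀ s0, 0 < s0 → s0 < gAbs π α β p →
      ENNReal.ofReal s0 ≤ dimH (univ : Set (ℕ → S)) by
    by_contra! hlt
    set d := dimH (univ : Set (ℕ → S)) with hd
    have hfin : d ≠ ⊤ := ne_top_of_lt hlt
    have hdr : d = ENNReal.ofReal d.toReal := (ENNReal.ofReal_toReal hfin).symm
    have h0 : 0 ≤ d.toReal := ENNReal.toReal_nonneg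
    rw [hdr] at hlt
    have hlt' : d.toReal < gAbs π α β p := (ENNReal.ofReal_lt_ofReal_iff_of_nonneg h0).1 hlt
    have := hmain ((d.toReal + gAbs π α β p) / 2) (by linarith) (by linarith)
    have := this.trans hdr.le
    rw [ENNReal.ofReal_le_ofReal_iff h0] at this
    linarith
  intro s0 hs0 hs1
  obtain ⟨μ, hprob, hcyl, hlln⟩ := exists_bernoulli p hp0 hp1
  have hχ : 0 < ∑ s, p s * α s := by
    have hne : ∃ s ∈ Finset.univ, 0 < p s := by
      by_contra! hcon
      have : ∑ s, p s ≤ 0 := Finset.sum_nonpos fun s hs => hcon s hs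
      linarith
    obtain ⟨s, hs, hps⟩ := hne
    exact Finset.sum_pos' (fun s _ => mul_nonneg (hp0 s) (hα s).le) ⟨s, hs, mul_pos hps (hα s)⟩
  set C : ℝ := 1 + ∑ s, α s + ∑ s, β s with hCdef
  have hαs : 0 ≤ ∑ s, α s := Finset.sum_nonneg fun s _ => (hα s).le
  have hβs : 0 ≤ ∑ s, β s := Finset.sum_nonneg fun s _ => (hβ s).le
  have hαC : ∀ s, α s ≤ C := fun s => by
    have := Finset.single_le_sum (f := α) (fun s _ => (hα s).le) (Finset.mem_univ s)
    linarith
  have hβC : ∀ s, β s ≤ C := fun s => by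
    have := Finset.single_le_sum (f := β) (fun s _ => (hβ s).le) (Finset.mem_univ s)
    linarith
  let E : ℕ → Set (ℕ → S) := fun N => {ω | ∀ t : ℝ, (N : ℝ) ≤ t →
    μ {y | edist ω y ≤ ENNReal.ofReal (Real.exp (-t))} ≤ ENNReal.ofReal (Real.exp (-(t * s0)))}
  have hae : ∀ᵐ ω ∂μ, ω ∈ ⋃ N, E N := by
    filter_upwards [hlln α, hlln β, hlln (fun s => -Real.log (p s)),
      hlln (fun s => -Real.log (marg π p (π s)))] with ω l1 l2 l3 l4
    have hr := rate_asymp (C := C) hχ hle (by linarith)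
      (T1 := fun n => ∑ k ∈ Finset.range n, α (ω k))
      (T2 := fun n => ∑ k ∈ Finset.range n, β (ω k))
      (Ap := fun n => ∑ k ∈ Finset.range n, (-Real.log (p (ω k))))
      (Aq := fun n => ∑ k ∈ Finset.range n, (-Real.log (marg π p (π (ω k)))))
      l1 l2 l3 l4 (by simp) (by simp)
      (fun n => by simp only [Finset.sum_range_succ]; linarith [hαC (ω n)])
      (fun n => by simp only [Finset.sum_range_succ]; linarith [hβC (ω n)])
    have hev := (hr.eventually (lt_mem_nhds hs1)).and (eventually_gt_atTop 0)
    obtain ⟨t0, ht0⟩ := eventually_atTop.1 hev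
    obtain ⟨N, hN⟩ := exists_nat_ge t0
    refine mem_iUnion.2 ⟨N, fun t ht => ?_⟩
    obtain ⟨hrt, htpos⟩ := ht0 t (hN.trans ht)
    rw [lt_div_iff₀ htpos] at hrt
    set L1 := fhit (fun n => ∑ k ∈ Finset.range n, α (ω k)) t with hL1
    set L2 := fhit (fun n => ∑ k ∈ Finset.range n, β (ω k)) t with hL2
    have hsub : {y | edist ω y ≤ ENNReal.ofReal (Real.exp (-t))} ⊆
        {y | (∀ k < min L1 L2, y k = ω k) ∧ ∀ k < L1, π (y k) = π (ω k)} := by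
      intro y hy
      have a1 : ∀ k < L1, edist ω y < ENNReal.ofReal (Real.exp (-∑ k ∈ Finset.range k, α (ω k))) := by
        intro k hk
        refine lt_of_le_of_lt hy ((ENNReal.ofReal_lt_ofReal_iff (Real.exp_pos _)).2 ?_)
        have := fhit_lt hk
        exact Real.exp_lt_exp.2 (by linarith)
      have a2 : ∀ k < L2, edist ω y < ENNReal.ofReal (Real.exp (-∑ k ∈ Finset.range k, β (ω k))) := by
        intro k hk
        refine lt_of_le_of_lt hy ((ENNReal.ofReal_lt_ofReal_iff (Real.exp_pos _)).2 ?_)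
        have := fhit_lt hk
        exact Real.exp_lt_exp.2 (by linarith)
      exact ⟨fun k hk => H2 ω y k (a1 k (lt_min_iff.1 hk).1) (a2 k (lt_min_iff.1 hk).2),
        fun k hk => H1 ω y k (a1 k hk)⟩
    refine (measure_mono hsub).trans
      ((ball_meas_le μ π p hp0 hcyl ω L1 (min L1 L2) (min_le_left _ _)).trans ?_)
    refine ENNReal.ofReal_le_ofReal (Real.exp_le_exp.2 ?_)
    linarith
  have hex : ∃ N, μ (E N) ≠ 0 := by
    by_contra! hcon
    have h0 : μ (⋃ N, E N) = 0 := measure_iUnion_null hcon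
    have h1 : μ (⋃ N, E N)ᶜ = 0 := hae
    have h2 : μ univ ≤ 0 := by
      rw [← union_compl_self (⋃ N, E N)]
      refine (measure_union_le _ _).trans ?_
      rw [h0, h1]; simp
    rw [hprob.measure_univ] at h2
    simp at h2
  obtain ⟨N, hN⟩ := hex
  refine le_trans (mass_dist (@Measure.toOuterMeasure _ (_) μ) (E N) hN hs0 (δ := Real.exp (-N)) (Real.exp_pos _) ?_)
    (dimH_mono (subset_univ _))
  intro x hx r hr0 hr1
  have h1 : (N : ℝ) ≤ -Real.log r := by
    have := Real.log_lt_log hr0 hr1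
    rw [Real.log_exp] at this
    linarith
  have h2 := hx _ h1
  rw [neg_neg, Real.exp_log hr0] at h2
  refine h2.trans (le_of_eq ?_)
  rw [Real.rpow_def_of_pos hr0]
  congr 2
  ring

end Lower

section Types
variable {ι S Γ : Type*} [Fintype ι]

open Classical in
/-- number of occurrences of a letter in a word -/
def cw (w : ι → S) (s : S) : ℕ := (Finset.univ.filter fun k => w k = s).card

lemma cw_pos (w : ι → S) (k : ι) : 0 < cw w (w k) :=
  Finset.card_pos.2 ⟨k, by simp⟩

lemma cw_le (w : ι → S) (s : S) : cw w s ≤ Fintype.card ι := by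
  classical
  exact Finset.card_le_univ _

lemma cw_unit (w : ι → S) (u : Unit) : cw ((fun _ : S => ()) ∘ w) u = Fintype.card ι := by
  classical
  simp [cw, Finset.card_univ]

variable [Fintype S]

lemma sum_cw (w : ι → S) (φ : S → ℝ) : ∑ s, (cw w s : ℝ) * φ s = ∑ k, φ (w k) := by
  classical
  have : ∀ s, (cw w s : ℝ) * φ s = ∑ k, if w k = s then φ s else 0 := by
    intro s
    rw [← Finset.sum_filter, Finset.sum_const, nsmul_eq_mul]
    simp only [cw]
  rw [Finset.sum_congr rfl (fun s _ => this s), Finset.sum_comm]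
  refine Finset.sum_congr rfl fun k _ => ?_
  simp

lemma sum_cw_fiber (π : S → Γ) (w : ι → S) (j : Γ) :
    ∑ s, (π ⁻¹' {j}).indicator (fun s => (cw w s : ℝ)) s = cw (π ∘ w) j := by
  classical
  have h := sum_cw w ((π ⁻¹' {j}).indicator (fun _ => (1:ℝ)))
  have e : ∀ s, (π ⁻¹' {j}).indicator (fun s => (cw w s : ℝ)) s =
      (cw w s : ℝ) * (π ⁻¹' {j}).indicator (fun _ => (1:ℝ)) s := by
    intro s
    by_cases hs : s ∈ π ⁻¹' {j} <;> simp [hs]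
  rw [Finset.sum_congr rfl (fun s _ => e s), h]
  simp only [Set.indicator_apply, mem_preimage, mem_singleton_iff, Finset.sum_boole, cw,
    Function.comp]

/-- conditional entropy of a word -/
def went (π : S → Γ) (w : ι → S) : ℝ :=
  ∑ k, (Real.log (cw (π ∘ w) (π (w k))) - Real.log (cw w (w k)))

lemma exp_neg_went (π : S → Γ) (w : ι → S) :
    Real.exp (-went π w) = ∏ k, ((cw w (w k) : ℝ) / cw (π ∘ w) (π (w k))) := by
  rw [went, ← Finset.sum_neg_distrib, Real.exp_sum]
  refine Finset.prod_congr rfl fun k _ => ?_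
  have h1 : (0:ℝ) < cw w (w k) := by exact_mod_cast cw_pos w k
  have h2 : (0:ℝ) < cw (π ∘ w) (π (w k)) := by exact_mod_cast cw_pos (π ∘ w) k
  rw [neg_sub, Real.exp_sub, Real.exp_log h1, Real.exp_log h2]

lemma type_count [DecidableEq ι] (π : S → Γ) (i : ι → Γ) [DecidableEq (ι → Γ)] :
    ∑ w : ι → S, (if π ∘ w = i then Real.exp (-went π w) else 0) ≤
      ((Fintype.card ι : ℝ) + 1) ^ Fintype.card S := by
  classical
  set n := Fintype.card ι with hn
  let V : Finset (S → Fin (n + 1)) := Finset.univ.filter fun N =>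
    ∀ k, ∑ s, (if π s = i k then ((N s : ℕ) : ℝ) else 0) ≤ cw i (i k)
  let f : (S → Fin (n + 1)) → ι → S → ℝ := fun N k s =>
    (if π s = i k then ((N s : ℕ) : ℝ) else 0) / cw i (i k)
  have hf0 : ∀ N k s, 0 ≤ f N k s := by
    intro N k s
    refine div_nonneg ?_ (Nat.cast_nonneg _)
    split_ifs <;> positivity
  have h1 : ∀ w : ι → S, (if π ∘ w = i then Real.exp (-went π w) else 0) ≤
      ∑ N ∈ V, ∏ k, f N k (w k) := by
    intro w
    split_ifs with hw
    · let N : S → Fin (n + 1) := fun s => ⟨cw w s, Nat.lt_succ_of_le (cw_le w s)⟩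
      have hN : N ∈ V := by
        refine Finset.mem_filter.2 ⟨Finset.mem_univ _, fun k => le_of_eq ?_⟩
        have := sum_cw_fiber π w (i k)
        rw [hw] at this
        rw [← this]
        refine Finset.sum_congr rfl fun s _ => ?_
        simp [N, Set.indicator_apply]
      refine le_trans (le_of_eq ?_) (Finset.single_le_sum (f := fun N => ∏ k, f N k (w k))
        (fun N _ => Finset.prod_nonneg fun k _ => hf0 N k (w k)) hN)
      rw [exp_neg_went]
      refine Finset.prod_congr rfl fun k _ => ?_
      have e : π (w k) = i k := congrFun hw k
      simp [f, N, e, hw]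
    · exact Finset.sum_nonneg fun N _ => Finset.prod_nonneg fun k _ => hf0 N k (w k)
  calc _ ≤ ∑ w : ι → S, ∑ N ∈ V, ∏ k, f N k (w k) := Finset.sum_le_sum fun w _ => h1 w
    _ = ∑ N ∈ V, ∑ w : ι → S, ∏ k, f N k (w k) := Finset.sum_comm
    _ = ∑ N ∈ V, ∏ k, ∑ s, f N k s := by
        refine Finset.sum_congr rfl fun N _ => ?_
        rw [Finset.prod_univ_sum, Fintype.piFinset_univ]
    _ ≤ ∑ N ∈ V, (1:ℝ) := by
        refine Finset.sum_le_sum fun N hN => ?_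
        refine Finset.prod_le_one (fun k _ => Finset.sum_nonneg fun s _ => hf0 N k s) fun k _ => ?_
        simp only [f]
        rw [← Finset.sum_div]
        exact div_le_one_of_le₀ ((Finset.mem_filter.1 hN).2 k) (Nat.cast_nonneg _)
    _ = V.card := by simp
    _ ≤ (Finset.univ : Finset (S → Fin (n + 1))).card := by
        exact_mod_cast Finset.card_le_card (Finset.filter_subset _ _)
    _ = _ := by simp [Finset.card_univ]

lemma type_count_unit [DecidableEq ι] :
    ∑ w : ι → S, Real.exp (-went (fun _ : S => ()) w) ≤
      ((Fintype.card ι : ℝ) + 1) ^ Fintype.card S := by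
  classical
  have := type_count (S := S) (fun _ : S => ()) (fun _ : ι => ())
  refine le_trans (le_of_eq ?_) this
  refine Finset.sum_congr rfl fun w _ => ?_
  rw [if_pos]
  rfl

lemma went_unit_nonneg (w : ι → S) : 0 ≤ went (fun _ : S => ()) w := by
  refine Finset.sum_nonneg fun k _ => ?_
  rw [cw_unit]
  have h1 : (0:ℝ) < cw w (w k) := by exact_mod_cast cw_pos w k
  have h2 : (cw w (w k) : ℝ) ≤ Fintype.card ι := by exact_mod_cast cw_le w (w k)
  linarith [Real.log_le_log h1 h2]

lemma went_unit_le (w : ι → S) : went (fun _ : S => ()) w ≤ Fintype.card S * Fintype.card ι := by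
  have h := sum_cw w (fun s => Real.log (Fintype.card ι) - Real.log (cw w s))
  have e : went (fun _ : S => ()) w = ∑ s, (cw w s : ℝ) *
      (Real.log (Fintype.card ι) - Real.log (cw w s)) := by
    rw [h, went]
    simp only [cw_unit]
  rw [e]
  have : ∀ s ∈ (Finset.univ : Finset S), (cw w s : ℝ) *
      (Real.log (Fintype.card ι) - Real.log (cw w s)) ≤ Fintype.card ι := by
    intro s _
    rcases Nat.eq_zero_or_pos (cw w s) with h0 | h0
    · simp [h0]
    · have hc : (0:ℝ) < cw w s := by exact_mod_cast h0
      have hi : (0:ℝ) < Fintype.card ι := by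
        have := h0.trans_le (cw_le w s)
        exact_mod_cast this
      rw [← Real.log_div hi.ne' hc.ne']
      have := Real.log_le_sub_one_of_pos (div_pos hi hc)
      calc _ ≤ (cw w s : ℝ) * ((Fintype.card ι : ℝ) / cw w s - 1) :=
            mul_le_mul_of_nonneg_left this hc.le
        _ = (Fintype.card ι : ℝ) - cw w s := by field_simp
        _ ≤ _ := by linarith
  refine (Finset.sum_le_sum this).trans (le_of_eq ?_)
  simp

/-- `g` at an empirical measure -/
lemma gAbs_emp [Fintype Γ] (π : S → Γ) (α β : S → ℝ) (w : ι → S) (hι : 0 < Fintype.card ι) :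
    gAbs π α β (fun s => (cw w s : ℝ) / Fintype.card ι) =
      went (fun _ : Γ => ()) (π ∘ w) / (∑ k, α (w k)) + went π w / (∑ k, β (w k)) := by
  have hn : (0:ℝ) < Fintype.card ι := by exact_mod_cast hι
  set n : ℝ := ((Fintype.card ι : ℕ) : ℝ) with hnd
  have hs : ∀ φ : S → ℝ, ∑ s, (cw w s : ℝ) / n * φ s = (∑ k, φ (w k)) / n := by
    intro φ
    rw [← sum_cw, Finset.sum_div]
    exact Finset.sum_congr rfl fun s _ => by ring
  have hm : ∀ j, marg π (fun s => (cw w s : ℝ) / n) j = cw (π ∘ w) j / n := by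
    intro j
    rw [← sum_cw_fiber, marg, Finset.sum_div]
    refine Finset.sum_congr rfl fun s _ => ?_
    by_cases h : s ∈ π ⁻¹' {j} <;> simp [h]
  unfold gAbs
  simp only [hm, hs]
  have e1 : ∑ k, -Real.log ((cw (π ∘ w) (π (w k)) : ℝ) / n) = went (fun _ : Γ => ()) (π ∘ w) := by
    refine Finset.sum_congr rfl fun k _ => ?_
    have h2 : (0:ℝ) < cw (π ∘ w) (π (w k)) := by exact_mod_cast cw_pos (π ∘ w) k
    rw [cw_unit, Real.log_div h2.ne' hn.ne']
    simp [hnd]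
  have e2 : ∑ k, -Real.log ((cw w (w k) : ℝ) / n) =
      went (fun _ : Γ => ()) (π ∘ w) + went π w := by
    rw [← e1, went, ← Finset.sum_add_distrib]
    refine Finset.sum_congr rfl fun k _ => ?_
    have h1 : (0:ℝ) < cw w (w k) := by exact_mod_cast cw_pos w k
    have h2 : (0:ℝ) < cw (π ∘ w) (π (w k)) := by exact_mod_cast cw_pos (π ∘ w) k
    rw [Real.log_div h2.ne' hn.ne', Real.log_div h1.ne' hn.ne']
    ring
  rw [e1, e2, ← sub_div, add_sub_cancel_left, div_div_div_cancel_right₀ hn.ne',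
    div_div_div_cancel_right₀ hn.ne']

end Types

section Chain

lemma exists_next {T1 : ℕ → ℝ} (hm : Monotone T1) (hT : Tendsto T1 atTop atTop) {n : ℕ} {t : ℝ}
    (h : T1 n ≤ t) : ∃ m, n ≤ m ∧ T1 m ≤ t ∧ t < T1 (m + 1) := by
  classical
  have hex : ∃ m, t < T1 m := (hT.eventually_gt_atTop t).exists
  have hM := Nat.find_spec hex
  have hnM : n < Nat.find hex := by
    by_contra! hle
    have := hm hle
    linarith
  refine ⟨Nat.find hex - 1, by omega, ?_, ?_⟩
  · have := Nat.find_min hex (m := Nat.find hex - 1) (by omega)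
    exact not_lt.1 this
  · rwa [Nat.sub_add_cancel (by omega)]

lemma chain_good {T1 T2 φ : ℕ → ℝ} (hm : Monotone T1) (hm2 : Monotone T2)
    (hT : Tendsto T1 atTop atTop) {B ε : ℝ} (hφ : ∀ n, φ n ≤ B) (hε : 0 < ε) {n0 : ℕ}
    (h0 : T1 n0 ≤ T2 n0) :
    ∃ n m, n0 ≤ n ∧ n ≤ m ∧ T1 n ≤ T2 n ∧ T1 m ≤ T2 n ∧ T2 n < T1 (m + 1) ∧ φ m ≤ φ n + ε := by
  by_contra! hcon
  have key : ∀ k : ℕ, ∃ n, n0 ≤ n ∧ T1 n ≤ T2 n ∧ φ n0 + k * ε ≤ φ n := by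
    intro k
    induction k with
    | zero => exact ⟨n0, le_rfl, h0, by simp⟩
    | succ k ih =>
      obtain ⟨n, hn, hc, hf⟩ := ih
      obtain ⟨m, hnm, h1, h2⟩ := exists_next hm hT hc
      have := hcon n m hn hnm hc h1 h2
      refine ⟨m, hn.trans hnm, h1.trans (hm2 hnm), ?_⟩
      push_cast
      linarith
  obtain ⟨k, hk⟩ := exists_nat_gt ((B - φ n0) / ε)
  obtain ⟨n, _, _, h⟩ := key k
  rw [div_lt_iff₀ hε] at hk
  linarith [hφ n]

end Chain

section Upper
variable {S Γ : Type*} [Fintype S] [Fintype Γ]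

lemma exists_pos_lower (α : S → ℝ) (hα : ∀ s, 0 < α s) : ∃ c, 0 < c ∧ ∀ s, c ≤ α s := by
  rcases isEmpty_or_nonempty S with h | h
  · exact ⟨1, one_pos, fun s => (h.false s).elim⟩
  · obtain ⟨s0, h0⟩ := Finite.exists_min α
    exact ⟨α s0, hα s0, h0⟩

/-- the weight of a pair of words used in the covering estimate -/
def pieceWeight (π : S → Γ) (δ : ℝ) (n m : ℕ) (x : (Fin m → Γ) × (Fin n → S)) : ℝ :=
  open Classical in
  if h : n ≤ m then
    (if π ∘ x.2 = x.1 ∘ Fin.castLE h then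
      Real.exp (-(δ * n)) * Real.exp (-(δ * m)) *
        (Real.exp (-went (fun _ : Γ => ()) x.1) * Real.exp (-went π x.2)) else 0)
  else 0

lemma pieceWeight_nonneg (π : S → Γ) (δ : ℝ) (n m : ℕ) (x : (Fin m → Γ) × (Fin n → S)) :
    0 ≤ pieceWeight π δ n m x := by
  unfold pieceWeight
  split_ifs <;> positivity

lemma pieceWeight_sum (π : S → Γ) (δ : ℝ) (n m : ℕ) :
    ∑ x, pieceWeight π δ n m x ≤
      (((n : ℝ) + 1) ^ Fintype.card S * Real.exp (-(δ * n))) *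
        (((m : ℝ) + 1) ^ Fintype.card Γ * Real.exp (-(δ * m))) := by
  classical
  unfold pieceWeight
  by_cases h : n ≤ m
  · simp only [h, dif_pos]
    rw [Fintype.sum_prod_type]
    have h1 : ∀ i : Fin m → Γ, (∑ w : Fin n → S, if π ∘ w = i ∘ Fin.castLE h then
        Real.exp (-(δ * n)) * Real.exp (-(δ * m)) *
        (Real.exp (-went (fun _ : Γ => ()) i) * Real.exp (-went π w)) else 0) ≤
        Real.exp (-(δ * n)) * Real.exp (-(δ * m)) * ((n : ℝ) + 1) ^ Fintype.card S *
          Real.exp (-went (fun _ : Γ => ()) i) := by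
      intro i
      have h2 := type_count π (i ∘ Fin.castLE h)
      rw [Fintype.card_fin] at h2
      calc _ = Real.exp (-(δ * n)) * Real.exp (-(δ * m)) * Real.exp (-went (fun _ : Γ => ()) i) *
            ∑ w : Fin n → S, (if π ∘ w = i ∘ Fin.castLE h then Real.exp (-went π w) else 0) := by
            rw [Finset.mul_sum]
            refine Finset.sum_congr rfl fun w _ => ?_
            split_ifs
            · ring
            · simp
        _ ≤ Real.exp (-(δ * n)) * Real.exp (-(δ * m)) * Real.exp (-went (fun _ : Γ => ()) i) *
            ((n : ℝ) + 1) ^ Fintype.card S := mul_le_mul_of_nonneg_left h2 (by positivity)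
        _ = _ := by ring
    have h3 := type_count_unit (ι := Fin m) (S := Γ)
    rw [Fintype.card_fin] at h3
    calc _ ≤ ∑ i : Fin m → Γ, Real.exp (-(δ * n)) * Real.exp (-(δ * m)) *
          ((n : ℝ) + 1) ^ Fintype.card S * Real.exp (-went (fun _ : Γ => ()) i) :=
          Finset.sum_le_sum fun i _ => h1 i
      _ = Real.exp (-(δ * n)) * Real.exp (-(δ * m)) * ((n : ℝ) + 1) ^ Fintype.card S *
          ∑ i : Fin m → Γ, Real.exp (-went (fun _ : Γ => ()) i) := by rw [Finset.mul_sum]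
      _ ≤ Real.exp (-(δ * n)) * Real.exp (-(δ * m)) * ((n : ℝ) + 1) ^ Fintype.card S *
          ((m : ℝ) + 1) ^ Fintype.card Γ := mul_le_mul_of_nonneg_left h3 (by positivity)
      _ = _ := by ring
  · simp only [h, dif_neg, not_false_iff, Finset.sum_const_zero]
    positivity

lemma summable_poly_exp (k : ℕ) {δ : ℝ} (hδ : 0 < δ) :
    Summable fun n : ℕ => ((n : ℝ) + 1) ^ k * Real.exp (-(δ * n)) := by
  have h := (summable_nat_add_iff 1).2 (Real.summable_pow_mul_exp_neg_nat_mul k hδ)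
  refine (h.mul_left (Real.exp δ)).congr fun n => ?_
  push_cast
  rw [mul_left_comm, ← Real.exp_add]
  congr 2
  ring

lemma pieceWeight_tsum (π : S → Γ) {δ : ℝ} (hδ : 0 < δ) :
    ∑' b : (Σ n : ℕ, Σ m : ℕ, (Fin m → Γ) × (Fin n → S)),
      ENNReal.ofReal (pieceWeight π δ b.1 b.2.1 b.2.2) ≠ ⊤ := by
  rw [ENNReal.tsum_sigma']
  have h1 : ∀ n : ℕ, (∑' c : (Σ m : ℕ, (Fin m → Γ) × (Fin n → S)),
      ENNReal.ofReal (pieceWeight π δ n c.1 c.2)) ≤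
      ENNReal.ofReal (((n : ℝ) + 1) ^ Fintype.card S * Real.exp (-(δ * n))) *
        ∑' m : ℕ, ENNReal.ofReal (((m : ℝ) + 1) ^ Fintype.card Γ * Real.exp (-(δ * m))) := by
    intro n
    rw [ENNReal.tsum_sigma', ← ENNReal.tsum_mul_left]
    refine ENNReal.tsum_le_tsum fun m => ?_
    classical
    rw [tsum_fintype, ← ENNReal.ofReal_sum_of_nonneg (fun x _ => pieceWeight_nonneg π δ n m x),
      ← ENNReal.ofReal_mul (by positivity)]
    exact ENNReal.ofReal_le_ofReal (pieceWeight_sum π δ n m)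
  refine ne_top_of_le_ne_top ?_ (ENNReal.tsum_le_tsum h1)
  rw [ENNReal.tsum_mul_right]
  exact ENNReal.mul_ne_top (summable_poly_exp _ hδ).tsum_ofReal_ne_top
    (summable_poly_exp _ hδ).tsum_ofReal_ne_top

theorem upper_bound [EMetricSpace (ℕ → S)] (π : S → Γ) (α β : S → ℝ)
    (hα : ∀ s, 0 < α s) (hβ : ∀ s, 0 < β s)
    (H : ∀ (ω ω' : ℕ → S) (n m : ℕ), (∀ k < n, ω k = ω' k) → (∀ k < m, π (ω k) = π (ω' k)) →
      edist ω ω' ≤ ENNReal.ofReal (max (Real.exp (-∑ k ∈ Finset.range m, α (ω k)))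
        (Real.exp (-∑ k ∈ Finset.range n, β (ω k)))))
    (s : ℝ) (hs : 0 ≤ s)
    (hg : ∀ p : S → ℝ, (∀ x, 0 ≤ p x) → ∑ x, p x = 1 →
      ∑ x, p x * α x ≤ ∑ x, p x * β x → gAbs π α β p ≤ s) :
    dimH {ω : ℕ → S | ∃ᶠ n in atTop, ∑ k ∈ Finset.range n, α (ω k) ≤
      ∑ k ∈ Finset.range n, β (ω k)} ≤ ENNReal.ofReal s := by
  set X1 := {ω : ℕ → S | ∃ᶠ n in atTop, ∑ k ∈ Finset.range n, α (ω k) ≤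
      ∑ k ∈ Finset.range n, β (ω k)} with hX1
  obtain ⟨c1, hc1, hc1'⟩ := exists_pos_lower α hα
  obtain ⟨c2, hc2, hc2'⟩ := exists_pos_lower β hβ
  set c := min c1 c2 with hc
  have hc0 : 0 < c := lt_min hc1 hc2
  have hcα : ∀ s, c ≤ α s := fun s => (min_le_left _ _).trans (hc1' s)
  have hcβ : ∀ s, c ≤ β s := fun s => (min_le_right _ _).trans (hc2' s)
  set C := ∑ x, α x with hC
  have hCα : ∀ x, α x ≤ C := fun x =>
    Finset.single_le_sum (f := α) (fun s _ => (hα s).le) (Finset.mem_univ x)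
  let T1 : (ℕ → S) → ℕ → ℝ := fun ω n => ∑ k ∈ Finset.range n, α (ω k)
  let T2 : (ℕ → S) → ℕ → ℝ := fun ω n => ∑ k ∈ Finset.range n, β (ω k)
  have hT1m : ∀ ω, Monotone (T1 ω) := fun ω => monotone_nat_of_le_succ fun n => by
    simp only [T1, Finset.sum_range_succ]; linarith [hα (ω n)]
  have hT2m : ∀ ω, Monotone (T2 ω) := fun ω => monotone_nat_of_le_succ fun n => by
    simp only [T2, Finset.sum_range_succ]; linarith [hβ (ω n)]
  have hT1c : ∀ ω (n : ℕ), c * n ≤ T1 ω n := by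
    intro ω n
    have := Finset.card_nsmul_le_sum (Finset.range n) (fun k => α (ω k)) c (fun k _ => hcα _)
    simpa [mul_comm] using this
  have hT2c : ∀ ω (n : ℕ), c * n ≤ T2 ω n := by
    intro ω n
    have := Finset.card_nsmul_le_sum (Finset.range n) (fun k => β (ω k)) c (fun k _ => hcβ _)
    simpa [mul_comm] using this
  have hT1t : ∀ ω, Tendsto (T1 ω) atTop atTop := fun ω =>
    tendsto_atTop_mono (hT1c ω) (tendsto_natCast_atTop_atTop.const_mul_atTop hc0)
  let rS : (ℕ → S) → (n : ℕ) → Fin n → S := fun ω n k => ω k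
  let rΓ : (ℕ → S) → (m : ℕ) → Fin m → Γ := fun ω m k => π (ω k)
  let En : (ℕ → S) → ℕ → ℝ := fun ω m => went (fun _ : Γ => ()) (rΓ ω m)
  let Dn : (ℕ → S) → ℕ → ℝ := fun ω n => went π (rS ω n)
  -- the estimate at an empirical measure
  have hemp : ∀ ω (n : ℕ), 0 < n → T1 ω n ≤ T2 ω n → En ω n / T1 ω n + Dn ω n / T2 ω n ≤ s := by
    intro ω n hn hle
    have hnR : (0:ℝ) < n := by exact_mod_cast hn
    have hsum : ∀ φ : S → ℝ, ∑ x, (cw (rS ω n) x : ℝ) / Fintype.card (Fin n) * φ x =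
        (∑ k ∈ Finset.range n, φ (ω k)) / n := by
      intro φ
      rw [Finset.sum_range, ← sum_cw (rS ω n), Finset.sum_div, Fintype.card_fin]
      exact Finset.sum_congr rfl fun s _ => by ring
    have h := hg (fun x => (cw (rS ω n) x : ℝ) / Fintype.card (Fin n)) (fun x => by positivity) ?_ ?_
    · rw [gAbs_emp π α β (rS ω n) (by simpa using hn)] at h
      have e1 : T1 ω n = ∑ k, α (rS ω n k) := Finset.sum_range _
      have e2 : T2 ω n = ∑ k, β (rS ω n k) := Finset.sum_range _
      rw [e1, e2]
      exact h
    · have := hsum (fun _ => 1)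
      simp only [mul_one] at this
      rw [this]
      simp [hnR.ne']
    · rw [hsum, hsum]
      exact div_le_div_of_nonneg_right hle hnR.le
  have hEn0 : ∀ ω n, 0 ≤ En ω n := fun ω n => went_unit_nonneg _
  have hφB : ∀ ω n, En ω n / T1 ω n ≤ Fintype.card Γ / c := by
    intro ω n
    rcases Nat.eq_zero_or_pos n with rfl | hn
    · have : T1 ω 0 = 0 := by simp [T1]
      rw [this, div_zero]
      positivity
    · have hnR : (0:ℝ) < n := by exact_mod_cast hn
      have h1 := went_unit_le (rΓ ω n)
      rw [Fintype.card_fin] at h1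
      calc _ ≤ (Fintype.card Γ * n : ℝ) / (c * n) :=
            div_le_div₀ (by positivity) h1 (by positivity) (hT1c ω n)
        _ = _ := by field_simp
  -- main claim
  have hmain : ∀ ε : ℝ, 0 < ε → dimH X1 ≤ ENNReal.ofReal (s + 2 * ε) := by
    intro ε hε
    borelize (ℕ → S)
    set s' := s + 2 * ε with hs'
    have hs'0 : 0 < s' := by linarith
    refine dimH_le_of_hausdorffMeasure_ne_top (d := s'.toNNReal) ?_
    rw [Real.coe_toNNReal _ hs'0.le]
    set δ := ε * c / 2 with hδ
    have hδ0 : 0 < δ := by positivity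
    let t : ℕ → (Σ n : ℕ, Σ m : ℕ, (Fin m → Γ) × (Fin n → S)) → Set (ℕ → S) := fun N b =>
      {ω | N ≤ b.1 ∧ b.1 ≤ b.2.1 ∧ b.2.2.2 = rS ω b.1 ∧ b.2.2.1 = rΓ ω b.2.1 ∧
        T1 ω b.2.1 ≤ T2 ω b.1 ∧ T2 ω b.1 < T1 ω (b.2.1 + 1) ∧
        Dn ω b.1 + En ω b.2.1 ≤ T2 ω b.1 * (s + ε)}
    have hdiam : ∀ N b, ∀ ω ∈ t N b, ediam (t N b) ≤ ENNReal.ofReal (Real.exp (C - T2 ω b.1)) := by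
      rintro N ⟨n, m, i, w⟩ ω hω
      refine ediam_le fun x hx y hy => ?_
      obtain ⟨-, hnm, hw, hi, h1, h2, -⟩ := hω
      obtain ⟨-, -, hwx, hix, h1x, h2x, -⟩ := hx
      obtain ⟨-, -, hwy, hiy, -⟩ := hy
      dsimp only at *
      have a1 : ∀ k < n, x k = y k := fun k hk => congrFun (hwx.symm.trans hwy) ⟨k, hk⟩
      have a2 : ∀ k < m, π (x k) = π (y k) := fun k hk => congrFun (hix.symm.trans hiy) ⟨k, hk⟩
      refine (H x y n m a1 a2).trans (ENNReal.ofReal_le_ofReal ?_)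
      have e2 : T2 ω n = T2 x n := by
        refine Finset.sum_congr rfl fun k hk => ?_
        have : ω k = x k := congrFun (hw.symm.trans hwx) ⟨k, Finset.mem_range.1 hk⟩
        rw [this]
      have e3 : T1 x (m + 1) ≤ T1 x m + C := by
        simp only [T1, Finset.sum_range_succ]; linarith [hCα (x m)]
      have e4 : 0 ≤ C := Finset.sum_nonneg fun s _ => (hα s).le
      refine max_le (Real.exp_le_exp.2 ?_) (Real.exp_le_exp.2 ?_)
      · change -T1 x m ≤ _
        linarith
      · change -T2 x n ≤ _
        linarith
    have hbound : ∀ N b, ediam (t N b) ^ s' ≤ ENNReal.ofReal (Real.exp (C * s')) *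
        ENNReal.ofReal (pieceWeight π δ b.1 b.2.1 b.2.2) := by
      intro N b
      rcases (t N b).eq_empty_or_nonempty with h0 | ⟨ω, hω⟩
      · rw [h0, ediam_empty, ENNReal.zero_rpow_of_pos hs'0]
        exact bot_le
      have hd := hdiam N b ω hω
      obtain ⟨n, m, i, w⟩ := b
      obtain ⟨hN, hnm, hw, hi, h1, h2, h3⟩ := hω
      dsimp only at *
      have hpw : pieceWeight π δ n m (i, w) = Real.exp (-(δ * n)) * Real.exp (-(δ * m)) *
          (Real.exp (-En ω m) * Real.exp (-Dn ω n)) := by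
        unfold pieceWeight
        rw [dif_pos hnm, if_pos]
        · simp only [hi, hw, En, Dn]
        · dsimp only
          rw [hi, hw]
          rfl
      rw [hpw, ← ENNReal.ofReal_mul (Real.exp_pos _).le]
      refine (ENNReal.rpow_le_rpow hd hs'0.le).trans ?_
      rw [ENNReal.ofReal_rpow_of_pos (Real.exp_pos _)]
      refine ENNReal.ofReal_le_ofReal ?_
      rw [← Real.exp_mul, ← Real.exp_add, ← Real.exp_add, ← Real.exp_add, ← Real.exp_add]
      refine Real.exp_le_exp.2 ?_
      have b1 := hT1c ω m
      have b2 := hT2c ω n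
      have b3 : δ * n + δ * m ≤ T2 ω n * ε := by
        rw [hδ]
        nlinarith
      rw [hs']
      nlinarith
    have hcover : ∀ N, X1 ⊆ ⋃ b, t N b := by
      intro N ω hω
      have hω' : ∃ᶠ n in atTop, T1 ω n ≤ T2 ω n := hω
      obtain ⟨n0, hn0, h0⟩ := frequently_atTop.1 hω' (N + 1)
      obtain ⟨n, m, hn, hnm, h1, h2, h3, h4⟩ := chain_good (φ := fun n => En ω n / T1 ω n)
        (hT1m ω) (hT2m ω) (hT1t ω) (hφB ω) hε h0
      refine mem_iUnion.2 ⟨⟨n, m, rΓ ω m, rS ω n⟩, by dsimp only; omega, hnm, rfl, rfl, h2, h3, ?_⟩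
      dsimp only
      have hnp : 0 < n := by omega
      have hnR : (0:ℝ) < n := by exact_mod_cast hnp
      have hmR : (0:ℝ) < m := by exact_mod_cast (hnp.trans_le hnm)
      have p2 : 0 < T2 ω n := lt_of_lt_of_le (by positivity) (hT2c ω n)
      have p1 : 0 < T1 ω m := lt_of_lt_of_le (by positivity) (hT1c ω m)
      have h5 := hemp ω n hnp h1
      have h6 : En ω m = T1 ω m * (En ω m / T1 ω m) := by field_simp
      have h7 : T1 ω m * (En ω m / T1 ω m) ≤ T2 ω n * (En ω m / T1 ω m) :=
        mul_le_mul_of_nonneg_right h2 (div_nonneg (hEn0 ω m) p1.le)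
      have h8 : Dn ω n = T2 ω n * (Dn ω n / T2 ω n) := by field_simp
      have h9 : Dn ω n / T2 ω n + En ω m / T1 ω m ≤ s + ε := by linarith
      calc Dn ω n + En ω m ≤ T2 ω n * (Dn ω n / T2 ω n) + T2 ω n * (En ω m / T1 ω m) := by
            rw [← h8]; linarith
        _ = T2 ω n * (Dn ω n / T2 ω n + En ω m / T1 ω m) := by ring
        _ ≤ _ := mul_le_mul_of_nonneg_left h9 p2.le
    have hr : Tendsto (fun N : ℕ => ENNReal.ofReal (Real.exp (C - c * N))) atTop (nhds 0) := by
      rw [← ENNReal.ofReal_zero]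
      refine ENNReal.tendsto_ofReal (Real.tendsto_exp_atBot.comp ?_)
      refine tendsto_atBot_add_const_left _ C (tendsto_neg_atTop_atBot.comp ?_)
      exact tendsto_natCast_atTop_atTop.const_mul_atTop hc0
    have hle := Measure.hausdorffMeasure_le_liminf_tsum s' X1 (l := atTop) _ hr t
      (Eventually.of_forall fun N b => by
        rcases (t N b).eq_empty_or_nonempty with h0 | ⟨ω, hω⟩
        · rw [h0, ediam_empty]; exact bot_le
        refine (hdiam N b ω hω).trans (ENNReal.ofReal_le_ofReal (Real.exp_le_exp.2 ?_))
        have h1 := hT2c ω b.1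
        have h2 : (N : ℝ) ≤ b.1 := by exact_mod_cast hω.1
        have := mul_le_mul_of_nonneg_left h2 hc0.le
        linarith)
      (Eventually.of_forall hcover)
    set Z := ENNReal.ofReal (Real.exp (C * s')) *
      ∑' b : (Σ n : ℕ, Σ m : ℕ, (Fin m → Γ) × (Fin n → S)),
        ENNReal.ofReal (pieceWeight π δ b.1 b.2.1 b.2.2) with hZ
    have hZt : Z ≠ ⊤ := ENNReal.mul_ne_top ENNReal.ofReal_ne_top (pieceWeight_tsum π hδ0)
    refine ne_top_of_le_ne_top hZt (hle.trans ?_)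
    have : liminf (fun _ : ℕ => Z) atTop = Z := liminf_const Z
    rw [← this]
    refine liminf_le_liminf (Eventually.of_forall fun N => ?_)
    rw [hZ, ← ENNReal.tsum_mul_left]
    exact ENNReal.tsum_le_tsum fun b => hbound N b
  -- let ε → 0
  have hlim : Tendsto (fun ε : ℝ => ENNReal.ofReal (s + 2 * ε)) (nhdsWithin 0 (Ioi 0))
      (nhds (ENNReal.ofReal s)) := by
    refine ENNReal.tendsto_ofReal ?_
    have : ContinuousAt (fun ε : ℝ => s + 2 * ε) 0 := by fun_prop
    have h := this.tendsto
    simp only [mul_zero, add_zero] at h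
    exact h.mono_left nhdsWithin_le_nhds
  refine ge_of_tendsto hlim ?_
  filter_upwards [self_mem_nhdsWithin] with ε hε
  exact hmain ε hε

end Upper

section Baranski

lemma exp_neg_sum_log {Γ : Type*} (a : Γ → ℝ) (ha : ∀ i, 0 < a i) (u : ℕ → Γ) (m : ℕ) :
    Real.exp (-∑ k ∈ Finset.range m, -Real.log (a (u k))) = ∏ k ∈ Finset.range m, a (u k) := by
  rw [Finset.sum_neg_distrib, neg_neg, Real.exp_sum]
  exact Finset.prod_congr rfl fun k _ => Real.exp_log (ha _)

lemma prod_range_anti {Γ : Type*} (a : Γ → ℝ) (ha : ∀ i, 0 < a i) (ha1 : ∀ i, a i < 1)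
    (u : ℕ → Γ) {m n : ℕ} (h : m ≤ n) :
    ∏ k ∈ Finset.range n, a (u k) ≤ ∏ k ∈ Finset.range m, a (u k) :=
  antitone_nat_of_succ_le (f := fun n => ∏ k ∈ Finset.range n, a (u k)) (fun n => by
    rw [Finset.prod_range_succ]
    exact mul_le_of_le_one_right (Finset.prod_nonneg fun k _ => (ha _).le) (ha1 _).le) h

lemma rho_lt_imp {Γ : Type*} (a : Γ → ℝ) (ha : ∀ i, 0 < a i) (ha1 : ∀ i, a i < 1)
    (u v : ℕ → Γ) (m : ℕ)
    (h : rhoDist (fun L => (L.map a).prod) u v <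
      Real.exp (-∑ k ∈ Finset.range m, -Real.log (a (u k)))) : v m = u m := by
  by_cases huv : u = v
  · rw [huv]
  obtain ⟨M, h1, -, h3⟩ := rhoDist_ne (fun L => (L.map a).prod) huv
  rw [h3, map_prod_pref, exp_neg_sum_log a ha] at h
  refine (h1 m ?_).symm
  by_contra! hle
  exact absurd (prod_range_anti a ha ha1 u hle) (not_le.2 h)

lemma rho_le_of {Γ : Type*} (a : Γ → ℝ) (ha : ∀ i, 0 < a i) (ha1 : ∀ i, a i < 1)
    (u v : ℕ → Γ) (m : ℕ) (h : ∀ k < m, u k = v k) :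
    rhoDist (fun L => (L.map a).prod) u v ≤
      Real.exp (-∑ k ∈ Finset.range m, -Real.log (a (u k))) := by
  by_cases huv : u = v
  · subst huv
    rw [rhoDist_self]
    exact (Real.exp_pos _).le
  obtain ⟨M, h1, h2, h3⟩ := rhoDist_ne (fun L => (L.map a).prod) huv
  rw [h3, map_prod_pref, exp_neg_sum_log a ha]
  refine prod_range_anti a ha ha1 u ?_
  by_contra! hlt
  exact h2 (h M hlt)

lemma neg_mul_log_le_one {x : ℝ} (hx : 0 ≤ x) : x * (-Real.log x) ≤ 1 := by
  rcases hx.eq_or_lt with rfl | hx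
  · simp
  have := Real.one_sub_inv_le_log_of_pos hx
  have h2 : x * (1 - x⁻¹) ≤ x * Real.log x := mul_le_mul_of_nonneg_left this hx.le
  rw [mul_sub, mul_inv_cancel₀ hx.ne'] at h2
  linarith

lemma gAbs_bdd {S Γ : Type*} [Fintype S] (π : S → Γ) (α β : S → ℝ) (hα : ∀ s, 0 < α s)
    (hβ : ∀ s, 0 < β s) : ∃ B : ℝ, ∀ p : S → ℝ, (∀ s, 0 ≤ p s) → ∑ s, p s = 1 →
      gAbs π α β p ≤ B := by
  obtain ⟨c1, hc1, hc1'⟩ := exists_pos_lower α hα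
  obtain ⟨c2, hc2, hc2'⟩ := exists_pos_lower β hβ
  refine ⟨Fintype.card S / c1 + Fintype.card S / c2, fun p hp0 hp1 => ?_⟩
  have hle : ∀ s, p s ≤ marg π p (π s) := fun s => by
    have h := Finset.single_le_sum (f := fun t => (π ⁻¹' {π s}).indicator p t)
      (fun t _ => Set.indicator_nonneg (fun t _ => hp0 t) t) (Finset.mem_univ s)
    simpa [marg] using h
  have hm1 : ∀ s, marg π p (π s) ≤ 1 := fun s => by
    rw [← hp1]
    exact Finset.sum_le_sum fun t _ => Set.indicator_le_self' (fun t _ => hp0 t) t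
  have h1 : ∀ s, p s * (-Real.log (marg π p (π s))) ≤ p s * (-Real.log (p s)) := fun s => by
    rcases (hp0 s).eq_or_lt with h | h
    · simp [← h]
    · exact mul_le_mul_of_nonneg_left (neg_le_neg (Real.log_le_log h (hle s))) h.le
  have h0 : ∀ s, 0 ≤ p s * (-Real.log (marg π p (π s))) := fun s =>
    mul_nonneg (hp0 s) (neg_nonneg.2 (Real.log_nonpos ((hp0 s).trans (hle s)) (hm1 s)))
  have hcard : ∀ φ : S → ℝ, (∀ s, φ s ≤ 1) → ∑ s, φ s ≤ Fintype.card S := fun φ hφ => by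
    have := Finset.sum_le_card_nsmul Finset.univ φ 1 (fun s _ => hφ s)
    simpa using this
  have hA : c1 ≤ ∑ s, p s * α s := by
    calc c1 = ∑ s, p s * c1 := by rw [← Finset.sum_mul, hp1, one_mul]
      _ ≤ _ := Finset.sum_le_sum fun s _ => mul_le_mul_of_nonneg_left (hc1' s) (hp0 s)
  have hB : c2 ≤ ∑ s, p s * β s := by
    calc c2 = ∑ s, p s * c2 := by rw [← Finset.sum_mul, hp1, one_mul]
      _ ≤ _ := Finset.sum_le_sum fun s _ => mul_le_mul_of_nonneg_left (hc2' s) (hp0 s)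
  have e1 := hcard _ (fun s => (h1 s).trans (neg_mul_log_le_one (hp0 s)))
  have e2 := hcard _ (fun s => neg_mul_log_le_one (hp0 s))
  have e3 := Finset.sum_nonneg (s := Finset.univ) (fun s _ => h0 s)
  unfold gAbs
  refine add_le_add ?_ ?_
  · exact div_le_div₀ (by positivity) e1 hc1 hA
  · exact div_le_div₀ (by positivity) (by linarith) hc2 hB

/-- abstract form of the function `g` -/
def gBoth {S Γ₁ Γ₂ : Type*} [Fintype S] (π₁ : S → Γ₁) (π₂ : S → Γ₂) (α β : S → ℝ)
    (p : S → ℝ) : ℝ :=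
  if ∑ s, p s * α s ≤ ∑ s, p s * β s then gAbs π₁ α β p else gAbs π₂ β α p

lemma gAbs_symm {S Γ₁ Γ₂ : Type*} [Fintype S] (π₁ : S → Γ₁) (π₂ : S → Γ₂) (α β : S → ℝ)
    (p : S → ℝ) (h : ∑ s, p s * α s = ∑ s, p s * β s) :
    gAbs π₂ β α p = gAbs π₁ α β p := by
  unfold gAbs
  rw [h]
  ring

theorem baranski_abs {S Γ₁ Γ₂ : Type*} [Fintype S] [Fintype Γ₁] [Fintype Γ₂]
    [MetricSpace (ℕ → S)] (π₁ : S → Γ₁) (π₂ : S → Γ₂)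
    (hinj : ∀ s t, π₁ s = π₁ t → π₂ s = π₂ t → s = t)
    (a : Γ₁ → ℝ) (b : Γ₂ → ℝ) (ha : ∀ i, 0 < a i) (ha1 : ∀ i, a i < 1)
    (hb : ∀ i, 0 < b i) (hb1 : ∀ i, b i < 1)
    (hdist : ∀ ω ω' : ℕ → S, dist ω ω' = max
      (rhoDist (fun L => (L.map a).prod) (fun k => π₁ (ω k)) (fun k => π₁ (ω' k)))
      (rhoDist (fun L => (L.map b).prod) (fun k => π₂ (ω k)) (fun k => π₂ (ω' k)))) :
    dimH (univ : Set (ℕ → S)) = ENNReal.ofReal (sSup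
      {t | ∃ p : S → ℝ, (∀ s, 0 ≤ p s) ∧ ∑ s, p s = 1 ∧
        gBoth π₁ π₂ (fun s => -Real.log (a (π₁ s))) (fun s => -Real.log (b (π₂ s))) p = t}) := by
  set α : S → ℝ := fun s => -Real.log (a (π₁ s)) with hαd
  set β : S → ℝ := fun s => -Real.log (b (π₂ s)) with hβd
  set T := {t | ∃ p : S → ℝ, (∀ s, 0 ≤ p s) ∧ ∑ s, p s = 1 ∧ gBoth π₁ π₂ α β p = t} with hT
  have hα : ∀ s, 0 < α s := fun s => neg_pos.2 (Real.log_neg (ha _) (ha1 _))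
  have hβ : ∀ s, 0 < β s := fun s => neg_pos.2 (Real.log_neg (hb _) (hb1 _))
  have hbdd : BddAbove T := by
    obtain ⟨B1, h1⟩ := gAbs_bdd π₁ α β hα hβ
    obtain ⟨B2, h2⟩ := gAbs_bdd π₂ β α hβ hα
    refine ⟨max B1 B2, ?_⟩
    rintro t ⟨p, hp0, hp1, rfl⟩
    unfold gBoth
    split_ifs
    · exact (h1 p hp0 hp1).trans (le_max_left _ _)
    · exact (h2 p hp0 hp1).trans (le_max_right _ _)
  have hlt1 : ∀ (ω ω' : ℕ → S) (m : ℕ),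
      edist ω ω' < ENNReal.ofReal (Real.exp (-∑ k ∈ Finset.range m, α (ω k))) →
      π₁ (ω' m) = π₁ (ω m) := by
    intro ω ω' m h
    rw [edist_dist, ENNReal.ofReal_lt_ofReal_iff (Real.exp_pos _), hdist] at h
    exact rho_lt_imp a ha ha1 (fun k => π₁ (ω k)) (fun k => π₁ (ω' k)) m
      ((le_max_left _ _).trans_lt h)
  have hlt2 : ∀ (ω ω' : ℕ → S) (m : ℕ),
      edist ω ω' < ENNReal.ofReal (Real.exp (-∑ k ∈ Finset.range m, β (ω k))) →
      π₂ (ω' m) = π₂ (ω m) := by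
    intro ω ω' m h
    rw [edist_dist, ENNReal.ofReal_lt_ofReal_iff (Real.exp_pos _), hdist] at h
    exact rho_lt_imp b hb hb1 (fun k => π₂ (ω k)) (fun k => π₂ (ω' k)) m
      ((le_max_right _ _).trans_lt h)
  have hlow : ∀ t ∈ T, ENNReal.ofReal t ≤ dimH (univ : Set (ℕ → S)) := by
    rintro t ⟨p, hp0, hp1, rfl⟩
    unfold gBoth
    split_ifs with hc
    · exact lower_bound π₁ α β hα hβ hlt1
        (fun ω ω' m h1 h2 => hinj _ _ (hlt1 ω ω' m h1) (hlt2 ω ω' m h2)) p hp0 hp1 hc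
    · exact lower_bound π₂ β α hβ hα hlt2
        (fun ω ω' m h1 h2 => hinj _ _ (hlt1 ω ω' m h2) (hlt2 ω ω' m h1)) p hp0 hp1
        (not_le.1 hc).le
  have hup : dimH (univ : Set (ℕ → S)) ≤ ENNReal.ofReal (max (sSup T) 0) := by
    have hsub : (univ : Set (ℕ → S)) ⊆
        {ω : ℕ → S | ∃ᶠ n in atTop, ∑ k ∈ Finset.range n, α (ω k) ≤
          ∑ k ∈ Finset.range n, β (ω k)} ∪
        {ω : ℕ → S | ∃ᶠ n in atTop, ∑ k ∈ Finset.range n, β (ω k) ≤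
          ∑ k ∈ Finset.range n, α (ω k)} := by
      intro ω _
      by_cases h : ∃ᶠ n in atTop, ∑ k ∈ Finset.range n, α (ω k) ≤ ∑ k ∈ Finset.range n, β (ω k)
      · exact Or.inl h
      · right
        rw [not_frequently] at h
        exact Eventually.frequently (h.mono fun n hn => (not_le.1 hn).le)
    refine (dimH_mono hsub).trans ?_
    rw [dimH_union]
    refine max_le ?_ ?_
    · refine upper_bound π₁ α β hα hβ ?_ _ (le_max_right _ _) ?_
      · intro ω ω' n m h1 h2
        rw [edist_dist, hdist]
        refine ENNReal.ofReal_le_ofReal (max_le_max ?_ ?_)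
        · exact rho_le_of a ha ha1 (fun k => π₁ (ω k)) (fun k => π₁ (ω' k)) m h2
        · exact rho_le_of b hb hb1 (fun k => π₂ (ω k)) (fun k => π₂ (ω' k)) n
            (fun k hk => congrArg π₂ (h1 k hk))
      · intro p hp0 hp1 hle
        refine le_trans (le_csSup hbdd ⟨p, hp0, hp1, ?_⟩) (le_max_left _ _)
        rw [gBoth, if_pos hle]
    · refine upper_bound π₂ β α hβ hα ?_ _ (le_max_right _ _) ?_
      · intro ω ω' n m h1 h2
        rw [edist_dist, hdist, max_comm]
        refine ENNReal.ofReal_le_ofReal (max_le_max ?_ ?_)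
        · exact rho_le_of b hb hb1 (fun k => π₂ (ω k)) (fun k => π₂ (ω' k)) m h2
        · exact rho_le_of a ha ha1 (fun k => π₁ (ω k)) (fun k => π₁ (ω' k)) n
            (fun k hk => congrArg π₁ (h1 k hk))
      · intro p hp0 hp1 hle
        refine le_trans (le_csSup hbdd ⟨p, hp0, hp1, ?_⟩) (le_max_left _ _)
        rw [gBoth]
        split_ifs with hc
        · exact (gAbs_symm π₁ π₂ α β p (le_antisymm hc hle)).symm
        · rfl
  have hmax : ENNReal.ofReal (max (sSup T) 0) = ENNReal.ofReal (sSup T) := by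
    rw [ENNReal.ofReal_max]; simp
  rw [hmax] at hup
  refine le_antisymm hup ?_
  have hfin : dimH (univ : Set (ℕ → S)) ≠ ⊤ := ne_top_of_le_ne_top ENNReal.ofReal_ne_top hup
  refine ENNReal.ofReal_le_of_le_toReal (Real.sSup_le (fun t ht => ?_) ENNReal.toReal_nonneg)
  exact (ENNReal.ofReal_le_iff_le_toReal hfin).1 (hlow t ht)

lemma sum_subtype_alph {Γ : Type*} [Fintype Γ] (A : Set Γ) [Fintype ↥A] (f : Γ → ℝ)
    (hf : ∀ x ∉ A, f x = 0) : ∑ x, f x = ∑ s : ↥A, f s := by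
  classical
  rw [← Finset.sum_subset (Finset.subset_univ A.toFinset) (fun x _ hx => hf x (by simpa using hx))]
  exact Finset.sum_subtype _ (by simp) f

lemma colSum_eq {Γ₁ Γ₂ : Type*} [Fintype Γ₁] [Fintype Γ₂] (A : Set (Γ₁ × Γ₂)) [Fintype ↥A]
    (P : Γ₁ × Γ₂ → ℝ) (hP : ∀ x ∉ A, P x = 0) (i : Γ₁) :
    colSum P i = marg (fun s : ↥A => s.1.1) (fun s => P s) i := by
  classical
  have h := sum_subtype_alph A (fun x => if x.1 = i then P x else 0)
    (fun x hx => by simp [hP x hx])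
  have h2 : ∑ x : Γ₁ × Γ₂, (if x.1 = i then P x else 0) = colSum P i := by
    rw [Fintype.sum_prod_type_right]
    simp [colSum]
  rw [← h2, h, marg]
  refine Finset.sum_congr rfl fun s _ => ?_
  simp [Set.indicator_apply]

lemma rowSum_eq {Γ₁ Γ₂ : Type*} [Fintype Γ₁] [Fintype Γ₂] (A : Set (Γ₁ × Γ₂)) [Fintype ↥A]
    (P : Γ₁ × Γ₂ → ℝ) (hP : ∀ x ∉ A, P x = 0) (j : Γ₂) :
    rowSum P j = marg (fun s : ↥A => s.1.2) (fun s => P s) j := by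
  classical
  have h := sum_subtype_alph A (fun x => if x.2 = j then P x else 0)
    (fun x hx => by simp [hP x hx])
  have h2 : ∑ x : Γ₁ × Γ₂, (if x.2 = j then P x else 0) = rowSum P j := by
    rw [Fintype.sum_prod_type]
    simp [rowSum]
  rw [← h2, h, marg]
  refine Finset.sum_congr rfl fun s _ => ?_
  simp [Set.indicator_apply]

lemma gFun_eq {Γ₁ Γ₂ : Type*} [Fintype Γ₁] [Fintype Γ₂] (A : Set (Γ₁ × Γ₂)) [Fintype ↥A]
    (P : Γ₁ × Γ₂ → ℝ) (hP : ∀ x ∉ A, P x = 0) (a : Γ₁ → ℝ) (b : Γ₂ → ℝ) :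
    gFun P a b = gBoth (fun s : ↥A => s.1.1) (fun s : ↥A => s.1.2)
      (fun s => -Real.log (a s.1.1)) (fun s => -Real.log (b s.1.2)) (fun s => P s) := by
  have hs : ∀ φ : Γ₁ × Γ₂ → ℝ, ∑ x, P x * φ x = -∑ s : ↥A, P s * (-φ s) := fun φ => by
    rw [sum_subtype_alph A (fun x => P x * φ x) (fun x hx => by simp [hP x hx])]
    simp
  unfold gFun gBoth gOne gTwo gAbs lyap1 lyap2
  simp only [← colSum_eq A P hP, ← rowSum_eq A P hP]
  rw [hs (fun x => Real.log (a x.1)), hs (fun x => Real.log (b x.2)),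
    hs (fun x => Real.log (colSum P x.1)), hs (fun x => Real.log (rowSum P x.2)),
    hs (fun x => Real.log (P x))]
  simp only [neg_le_neg_iff]
  congr 1
  · rw [neg_div_neg_eq, ← neg_sub_neg, neg_neg, neg_neg, ← neg_sub, neg_div_neg_eq]
  · rw [neg_div_neg_eq, ← neg_sub_neg, neg_neg, neg_neg, ← neg_sub, neg_div_neg_eq]

theorem baranski_dim {Γ₁ Γ₂ : Type*} [Fintype Γ₁] [Fintype Γ₂] (A : Set (Γ₁ × Γ₂))
    (a : Γ₁ → ℝ) (b : Γ₂ → ℝ) (ha : ∀ i, 0 < a i) (ha1 : ∀ i, a i < 1)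
    (hb : ∀ i, 0 < b i) (hb1 : ∀ i, b i < 1) [MetricSpace (ℕ → ↥A)]
    (hdist : ∀ ω ω' : ℕ → ↥A, dist ω ω' = baranskiDist A a b ω ω') :
    dimH (univ : Set (ℕ → ↥A)) =
      ENNReal.ofReal (sSup {t | ∃ p, IsProbVec A p ∧ gFun p a b = t}) := by
  classical
  have : Fintype ↥A := Fintype.ofFinite _
  rw [baranski_abs (fun s : ↥A => s.1.1) (fun s : ↥A => s.1.2)
    (fun s t h1 h2 => Subtype.ext (Prod.ext h1 h2)) a b ha ha1 hb hb1 hdist]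
  congr 2
  ext t
  constructor
  · rintro ⟨p, hp0, hp1, rfl⟩
    set P : Γ₁ × Γ₂ → ℝ := fun x => if h : x ∈ A then p ⟨x, h⟩ else 0 with hPd
    have hP : ∀ x ∉ A, P x = 0 := fun x hx => by simp [hPd, hx]
    have hPp : (fun s : ↥A => P s) = p := by
      funext s
      simp [hPd]
    refine ⟨P, ⟨fun x => ?_, hP, ?_⟩, ?_⟩
    · simp only [hPd]
      split_ifs
      · exact hp0 _
      · exact le_rfl
    · rw [sum_subtype_alph A P hP, hPp, hp1]
    · rw [gFun_eq A P hP, hPp]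
  · rintro ⟨P, ⟨h0, hP, h1⟩, rfl⟩
    refine ⟨fun s => P s, fun s => h0 _, ?_, (gFun_eq A P hP a b).symm⟩
    rw [← sum_subtype_alph A P hP, h1]

end Baranski

section Final

/-- Regrouping a sequence over `A` into a sequence over the block alphabet. -/
def blockMap {Λ₁ Λ₂ : Type*} (A : Set (Λ₁ × Λ₂)) (n : ℕ) (ω : ℕ → ↥A) :
    ℕ → ↥(blockAlphabet A n) := fun k =>
  ⟨(fun l => (ω (k * n + l.val)).1.1, fun l => (ω (k * n + l.val)).1.2),
    fun l => (ω (k * n + l.val)).2⟩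

lemma blockMap_surjective {Λ₁ Λ₂ : Type*} (A : Set (Λ₁ × Λ₂)) {n : ℕ} (hn : 0 < n) :
    Function.Surjective (blockMap A n) := by
  intro η
  refine ⟨fun k => ⟨((η (k / n)).1.1 ⟨k % n, Nat.mod_lt _ hn⟩,
    (η (k / n)).1.2 ⟨k % n, Nat.mod_lt _ hn⟩), (η (k / n)).2 _⟩, ?_⟩
  have hd : ∀ (k : ℕ) (l : Fin n), (k * n + l.val) / n = k := fun k l => by
    rw [mul_comm, Nat.mul_add_div hn, Nat.div_eq_of_lt l.2, add_zero]
  have hm : ∀ (k : ℕ) (l : Fin n), (k * n + l.val) % n = l.val := fun k l => by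
    rw [mul_comm, Nat.mul_add_mod, Nat.mod_eq_of_lt l.2]
  funext k
  refine Subtype.ext (Prod.ext ?_ ?_)
  · funext l
    simp only [blockMap, hd, hm]
  · funext l
    simp only [blockMap, hd, hm]

theorem dim_le_block {Λ₁ Λ₂ : Type*} {A : Set (Λ₁ × Λ₂)} {N₁ : List Λ₁ → ℝ} {N₂ : List Λ₂ → ℝ}
    {ρ₁ K₁ c₁ ρ₂ K₂ c₂ : ℝ} (h₁ : NormFacts N₁ ρ₁ K₁ c₁) (h₂ : NormFacts N₂ ρ₂ K₂ c₂)
    [MetricSpace (ℕ → ↥A)]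
    (hdist : ∀ ω ω' : ℕ → ↥A, dist ω ω' = max
      (rhoDist N₁ (fun k => (ω k).1.1) (fun k => (ω' k).1.1))
      (rhoDist N₂ (fun k => (ω k).1.2) (fun k => (ω' k).1.2)))
    {n : ℕ} (hn : 0 < n) [MetricSpace (ℕ → ↥(blockAlphabet A n))]
    (hD : ∀ ω ω' : ℕ → ↥(blockAlphabet A n), dist ω ω' =
      baranskiDist (blockAlphabet A n) (fun i : Fin n → Λ₁ => N₁ (List.ofFn i))
        (fun j : Fin n → Λ₂ => N₂ (List.ofFn j)) ω ω') :
    dimH (univ : Set (ℕ → ↥A)) ≤ dimH (univ : Set (ℕ → ↥(blockAlphabet A n))) := by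
  have hanti : AntilipschitzWith 1 (blockMap A n) := by
    refine AntilipschitzWith.of_le_mul_dist fun ω ω' => ?_
    rw [NNReal.coe_one, one_mul, hdist, hD]
    exact max_le_max
      (rho_le_block h₁ hn (fun k => (ω k).1.1) (fun k => (ω' k).1.1))
      (rho_le_block h₂ hn (fun k => (ω k).1.2) (fun k => (ω' k).1.2))
  exact (hanti.le_dimH_image univ).trans (dimH_mono (subset_univ _))

theorem block_le_dim {Λ₁ Λ₂ : Type*} {A : Set (Λ₁ × Λ₂)} {N₁ : List Λ₁ → ℝ} {N₂ : List Λ₂ → ℝ}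
    [MetricSpace (ℕ → ↥A)]
    (hdist : ∀ ω ω' : ℕ → ↥A, dist ω ω' = max
      (rhoDist N₁ (fun k => (ω k).1.1) (fun k => (ω' k).1.1))
      (rhoDist N₂ (fun k => (ω k).1.2) (fun k => (ω' k).1.2)))
    (hN₁ : ∀ u v, 0 ≤ rhoDist N₁ u v) (hN₂ : ∀ u v, 0 ≤ rhoDist N₂ u v)
    {n : ℕ} (hn : 0 < n) {ε C₁ C₂ : ℝ} (hε1 : ε < 1) (hC₁ : 0 ≤ C₁)
    (hb₁ : ∀ u v : ℕ → Λ₁,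
      rhoDist (fun L => (L.map (fun i : Fin n → Λ₁ => N₁ (List.ofFn i))).prod) (blk n u) (blk n v)
        ≤ C₁ * (rhoDist N₁ u v) ^ (1 - ε))
    (hb₂ : ∀ u v : ℕ → Λ₂,
      rhoDist (fun L => (L.map (fun i : Fin n → Λ₂ => N₂ (List.ofFn i))).prod) (blk n u) (blk n v)
        ≤ C₂ * (rhoDist N₂ u v) ^ (1 - ε))
    [MetricSpace (ℕ → ↥(blockAlphabet A n))]
    (hD : ∀ ω ω' : ℕ → ↥(blockAlphabet A n), dist ω ω' =
      baranskiDist (blockAlphabet A n) (fun i : Fin n → Λ₁ => N₁ (List.ofFn i))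
        (fun j : Fin n → Λ₂ => N₂ (List.ofFn j)) ω ω') :
    dimH (univ : Set (ℕ → ↥(blockAlphabet A n))) ≤
      dimH (univ : Set (ℕ → ↥A)) / ENNReal.ofReal (1 - ε) := by
  have hr : 0 < (1 - ε).toNNReal := Real.toNNReal_pos.2 (by linarith)
  have hrc : ((1 - ε).toNNReal : ℝ) = 1 - ε := Real.coe_toNNReal _ (by linarith)
  set C := max C₁ C₂ with hC
  have hC0 : 0 ≤ C := hC₁.trans (le_max_left _ _)
  have hH : HolderWith C.toNNReal (1 - ε).toNNReal (blockMap A n) := by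
    intro ω ω'
    have hreal : dist (blockMap A n ω) (blockMap A n ω') ≤ C * dist ω ω' ^ (1 - ε) := by
      rw [hD, hdist]
      refine max_le ?_ ?_
      · refine (hb₁ (fun k => (ω k).1.1) (fun k => (ω' k).1.1)).trans ?_
        refine mul_le_mul (le_max_left _ _) ?_ (Real.rpow_nonneg (hN₁ _ _) _) hC0
        exact Real.rpow_le_rpow (hN₁ _ _) (le_max_left _ _) (by linarith)
      · refine (hb₂ (fun k => (ω k).1.2) (fun k => (ω' k).1.2)).trans ?_
        refine mul_le_mul (le_max_right _ _) ?_ (Real.rpow_nonneg (hN₂ _ _) _) hC0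
        exact Real.rpow_le_rpow (hN₂ _ _) (le_max_right _ _) (by linarith)
    rw [edist_dist, edist_dist, hrc, ENNReal.ofReal_rpow_of_nonneg dist_nonneg (by linarith)]
    change _ ≤ ENNReal.ofReal C * _
    rw [← ENNReal.ofReal_mul hC0]
    exact ENNReal.ofReal_le_ofReal hreal
  have := hH.dimH_range_le hr
  rwa [(blockMap_surjective A hn).range_eq] at this

lemma rhoDist_nonneg {Γ : Type*} {N : List Γ → ℝ} {ρ K c : ℝ} (hN : NormFacts N ρ K c)
    (u v : ℕ → Γ) : 0 ≤ rhoDist N u v := by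
  by_cases h : u = v
  · subst h
    rw [rhoDist_self]
  · obtain ⟨M, -, -, h3⟩ := rhoDist_ne N h
    rw [h3]
    exact (hN.pos _).le

lemma block_lt_one {Γ : Type*} {N : List Γ → ℝ} {ρ K c : ℝ} (hN : NormFacts N ρ K c)
    {n : ℕ} (hn : 0 < n) (i : Fin n → Γ) : N (List.ofFn i) < 1 := by
  refine (hN.upper _).trans_lt ?_
  rw [List.length_ofFn]
  exact pow_lt_one₀ hN.ρ0.le hN.ρ1 hn.ne'

lemma tendsto_of_squeeze_div {d : ℝ≥0∞} {x : ℕ → ℝ≥0∞} (hlow : ∀ᶠ n in atTop, d ≤ x n)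
    (hup : ∀ ε : ℝ, 0 < ε → ε < 1 → ∀ᶠ n in atTop, x n ≤ d / ENNReal.ofReal (1 - ε)) :
    Tendsto x atTop (nhds d) := by
  have hlim : Tendsto (fun ε : ℝ => d / ENNReal.ofReal (1 - ε)) (nhdsWithin 0 (Ioi 0))
      (nhds d) := by
    have h1 : Tendsto (fun ε : ℝ => ENNReal.ofReal (1 - ε)) (nhdsWithin 0 (Ioi 0)) (nhds 1) := by
      have : Tendsto (fun ε : ℝ => 1 - ε) (nhds 0) (nhds (1 - 0)) :=
        tendsto_const_nhds.sub tendsto_id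
      rw [sub_zero] at this
      simpa using (ENNReal.tendsto_ofReal this).mono_left nhdsWithin_le_nhds
    have := ENNReal.Tendsto.div (tendsto_const_nhds (x := d)) (Or.inr one_ne_zero) h1
      (Or.inl ENNReal.one_ne_top)
    simpa using this
  refine tendsto_order.2 ⟨fun y hy => hlow.mono fun n hn => hy.trans_le hn, fun y hy => ?_⟩
  have h2 := hlim.eventually (gt_mem_nhds hy)
  have h3 : ∀ᶠ ε : ℝ in nhdsWithin 0 (Ioi 0), ε ∈ Ioo (0:ℝ) 1 :=
    Ioo_mem_nhdsGT one_pos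
  obtain ⟨ε, h4, h5⟩ := (h2.and h3).exists
  exact (hup ε h5.1 h5.2).mono fun n hn => hn.trans_lt h4

end Final

/-- The Hausdorff dimension of the symbolic space `(Σ,d)` is the limit of the
Hausdorff dimensions of the symbolic Barański carpets `(Σ_n, d[a_n,b_n])`, which is also the
limit of the maxima of `g(·, a_n, b_n)`. -/
theorem stmt5 {Λ₁ Λ₂ : Type} [Fintype Λ₁] [Fintype Λ₂] [Nonempty Λ₁] [Nonempty Λ₂]
    (F : ConformalIFS Λ₁) (G : ConformalIFS Λ₂)
    (A : Set (Λ₁ × Λ₂)) (hA : A.Nonempty)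
    [MetricSpace (ℕ → ↥A)]
    (hdist : ∀ ω₁ ω₂ : ℕ → ↥A, dist ω₁ ω₂ = symbolicDist F G A ω₁ ω₂)
    (D : ∀ n : ℕ, MetricSpace (ℕ → ↥(blockAlphabet A n)))
    (hD : ∀ n : ℕ, ∀ ω₁ ω₂ : ℕ → ↥(blockAlphabet A n),
      @dist _ (D n).toDist ω₁ ω₂ =
        baranskiDist (blockAlphabet A n)
          (fun i : Fin n → Λ₁ => wordDerivNorm F.f F.f' (List.ofFn i))
          (fun j : Fin n → Λ₂ => wordDerivNorm G.f G.f' (List.ofFn j)) ω₁ ω₂) :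
    Tendsto
      (fun n : ℕ =>
        @dimH _ (@MetricSpace.toEMetricSpace _ (D n)) (univ : Set (ℕ → ↥(blockAlphabet A n))))
      atTop (nhds (dimH (univ : Set (ℕ → ↥A)))) ∧
    Tendsto
      (fun n : ℕ => ENNReal.ofReal (sSup
        {t | ∃ p, IsProbVec (blockAlphabet A n) p ∧
          gFun p (fun i : Fin n → Λ₁ => wordDerivNorm F.f F.f' (List.ofFn i))
            (fun j : Fin n → Λ₂ => wordDerivNorm G.f G.f' (List.ofFn j)) = t}))
      atTop (nhds (dimH (univ : Set (ℕ → ↥A)))) := by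
  obtain ⟨ρ₁, K₁, c₁, h₁⟩ := ifs_facts F
  obtain ⟨ρ₂, K₂, c₂, h₂⟩ := ifs_facts G
  have hfirst : Tendsto
      (fun n : ℕ =>
        @dimH _ (@MetricSpace.toEMetricSpace _ (D n)) (univ : Set (ℕ → ↥(blockAlphabet A n))))
      atTop (nhds (dimH (univ : Set (ℕ → ↥A)))) := by
    refine tendsto_of_squeeze_div ?_ ?_
    · filter_upwards [eventually_gt_atTop 0] with n hn
      letI := D n
      exact dim_le_block h₁ h₂ hdist hn (hD n)
    · intro ε hε hε1
      filter_upwards [eventually_gt_atTop 0, block_le_rho h₁ hε hε1, block_le_rho h₂ hε hε1]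
        with n hn hC₁ hC₂
      obtain ⟨C₁, hC₁, hb₁⟩ := hC₁
      obtain ⟨C₂, hC₂, hb₂⟩ := hC₂
      letI := D n
      exact block_le_dim hdist (rhoDist_nonneg h₁) (rhoDist_nonneg h₂) hn hε1 hC₁ hb₁ hb₂ (hD n)
  refine ⟨hfirst, hfirst.congr' ?_⟩
  filter_upwards [eventually_gt_atTop 0] with n hn
  letI := D n
  exact baranski_dim (blockAlphabet A n) _ _ (fun i => h₁.pos _) (block_lt_one h₁ hn)
    (fun i => h₂.pos _) (block_lt_one h₂ hn) (hD n)

end
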